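/- arXiv:2104.11204 — 3 statements merged into one kernel-verified Lean document; each statement's English description precedes it below -/
import Mathlib

section
/- There is an absolute constant C such that for every prime couple Q_sk and every natural number n, the number of couples Q whose skeleton equals Q_sk and whose scale is at most n is at most C^n. -/
namespace WKE

/-! Combinatorial framework: ternary trees, couples, steps A and B, regular couples.
Following Deng–Hani, "Full derivation of the wave kinetic equation". -/

/-- A ternary tree: every non-leaf (branching) node has exactly three ordered children. -/
inductive TTree : Type where
  | leaf : TTree
  | node : TTree → TTree → TTree → TTree
  deriving DecidableEq

/-- The scale of a tree: its number of branching nodes. -/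
def TTree.scale : TTree → ℕ
  | .leaf => 0
  | .node a b c => a.scale + b.scale + c.scale + 1

/-- A position (address) of a node in a ternary tree. -/
abbrev Pos : Type := List (Fin 3)

/-- A node of a couple: a side (`true` = the `+` tree) together with a position. -/
abbrev NodeId : Type := Bool × Pos

/-- The subtree at a given position, if the position is valid. -/
def TTree.subtreeAt? : TTree → Pos → Option TTree
  | t, [] => some t
  | .leaf, _ :: _ => none
  | .node a _ _, ⟨0, _⟩ :: p => a.subtreeAt? p
  | .node _ b _, ⟨1, _⟩ :: p => b.subtreeAt? p
  | .node _ _ c, ⟨_ + 2, _⟩ :: p => c.subtreeAt? p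

/-- `p` is the position of a leaf of `t`. -/
def TTree.IsLeafPos (t : TTree) (p : Pos) : Prop := t.subtreeAt? p = some .leaf

/-- `p` is the position of a branching node of `t`. -/
def TTree.IsBranchPos (t : TTree) (p : Pos) : Prop :=
  ∃ a b c, t.subtreeAt? p = some (.node a b c)

instance (t : TTree) (p : Pos) : Decidable (t.IsLeafPos p) := by
  unfold TTree.IsLeafPos; infer_instance

/-- The sign of the node at position `p` in a tree whose root has sign `b`
(`true` = `+`): the sign flips exactly when passing to a middle child. -/
def posSign (b : Bool) (p : Pos) : Bool := Bool.xor b (p.count (1 : Fin 3) % 2 == 1)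

/-- A couple: a pair of ternary trees of signs `+` and `-`, together with a partition of the
set of all leaves into pairs of leaves of opposite signs.  The pairing is encoded as a
fixed-point-free involution of the set of leaves, extended by the identity off the leaves. -/
structure Couple where
  pos : TTree
  neg : TTree
  pair : NodeId → NodeId
  pair_leaf : ∀ x : NodeId, (cond x.1 pos neg).IsLeafPos x.2 →
    (cond (pair x).1 pos neg).IsLeafPos (pair x).2
  pair_invol : ∀ x : NodeId, (cond x.1 pos neg).IsLeafPos x.2 → pair (pair x) = x
  pair_ne : ∀ x : NodeId, (cond x.1 pos neg).IsLeafPos x.2 → pair x ≠ x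
  pair_sign : ∀ x : NodeId, (cond x.1 pos neg).IsLeafPos x.2 →
    posSign (pair x).1 (pair x).2 = !(posSign x.1 x.2)
  pair_norm : ∀ x : NodeId, ¬ (cond x.1 pos neg).IsLeafPos x.2 → pair x = x

/-- The tree of a couple on a given side. -/
def Couple.treeOf (Q : Couple) (b : Bool) : TTree := cond b Q.pos Q.neg

/-- `x` is a leaf of the couple `Q`. -/
def Couple.IsLeaf (Q : Couple) (x : NodeId) : Prop := (Q.treeOf x.1).IsLeafPos x.2

/-- `x` is a branching node of the couple `Q`. -/
def Couple.IsBranch (Q : Couple) (x : NodeId) : Prop := (Q.treeOf x.1).IsBranchPos x.2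

/-- `x` is a node of the couple `Q`. -/
def Couple.IsNode (Q : Couple) (x : NodeId) : Prop := ((Q.treeOf x.1).subtreeAt? x.2).isSome

/-- The scale of a couple: the sum of the scales of its two trees. -/
def Couple.scale (Q : Couple) : ℕ := Q.pos.scale + Q.neg.scale

theorem isLeafPos_leaf_iff (p : Pos) : TTree.IsLeafPos .leaf p ↔ p = [] := by
  cases p with
  | nil => simp [TTree.IsLeafPos, TTree.subtreeAt?]
  | cons i q => simp [TTree.IsLeafPos, TTree.subtreeAt?]

/-- The pairing of the trivial couple: the two roots are paired. -/
def trivPair : NodeId → NodeId := fun x =>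
  if x = ((true, []) : NodeId) then ((false, []) : NodeId)
  else if x = ((false, []) : NodeId) then ((true, []) : NodeId) else x

/-- The trivial couple: two single-node trees with their roots paired. -/
def trivialCouple : Couple where
  pos := .leaf
  neg := .leaf
  pair := trivPair
  pair_leaf := by
    rintro ⟨b, p⟩ hp
    have hp' : p = [] := by cases b <;> exact (isLeafPos_leaf_iff p).mp hp
    subst hp'
    cases b <;> decide
  pair_invol := by
    rintro ⟨b, p⟩ hp
    have hp' : p = [] := by cases b <;> exact (isLeafPos_leaf_iff p).mp hp
    subst hp'
    cases b <;> decide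
  pair_ne := by
    rintro ⟨b, p⟩ hp
    have hp' : p = [] := by cases b <;> exact (isLeafPos_leaf_iff p).mp hp
    subst hp'
    cases b <;> decide
  pair_sign := by
    rintro ⟨b, p⟩ hp
    have hp' : p = [] := by cases b <;> exact (isLeafPos_leaf_iff p).mp hp
    subst hp'
    cases b <;> decide
  pair_norm := by
    rintro ⟨b, p⟩ hp
    rcases p with _ | ⟨i, q⟩
    · exfalso
      apply hp
      cases b <;> exact (isLeafPos_leaf_iff []).mpr rfl
    · simp [trivPair]

/-- Replace the subtree at position `p` of `t` by `s`. -/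
def TTree.replaceAt : TTree → Pos → TTree → TTree
  | _, [], s => s
  | .leaf, _ :: _, _ => .leaf
  | .node a b c, ⟨0, _⟩ :: p, s => .node (a.replaceAt p s) b c
  | .node a b c, ⟨1, _⟩ :: p, s => .node a (b.replaceAt p s) c
  | .node a b c, ⟨_ + 2, _⟩ :: p, s => .node a b (c.replaceAt p s)

/-- The ternary tree of scale 1. -/
def oneTree : TTree := .node .leaf .leaf .leaf

/-- Normalize a candidate pairing function: act by `f` on the leaves of the couple with
trees `P`, `N`, and by the identity elsewhere. -/
def normalizePair (P N : TTree) (f : NodeId → NodeId) : NodeId → NodeId :=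
  fun x => if (cond x.1 P N).IsLeafPos x.2 then f x else x

/-- The transposition of `0` and `2` in `Fin 3`. -/
def swap02 : Fin 3 → Fin 3 := fun i => if i = 0 then 2 else if i = 2 then 0 else 1

/-- The new (raw) pairing after step A performed at the leaf pair `{l, l'}`; the children
of `l` are paired to the children of `l'` according to `σ` (which is `id` or `swap02`),
corresponding to the two possible (1,1)-mini couples. -/
def stepAPairRaw (f : NodeId → NodeId) (l l' : NodeId) (σ : Fin 3 → Fin 3) :
    NodeId → NodeId := fun x =>
  if x = (l.1, l.2 ++ [(0 : Fin 3)]) then (l'.1, l'.2 ++ [σ 0])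
  else if x = (l.1, l.2 ++ [(1 : Fin 3)]) then (l'.1, l'.2 ++ [σ 1])
  else if x = (l.1, l.2 ++ [(2 : Fin 3)]) then (l'.1, l'.2 ++ [σ 2])
  else if x = (l'.1, l'.2 ++ [σ 0]) then (l.1, l.2 ++ [(0 : Fin 3)])
  else if x = (l'.1, l'.2 ++ [σ 1]) then (l.1, l.2 ++ [(1 : Fin 3)])
  else if x = (l'.1, l'.2 ++ [σ 2]) then (l.1, l.2 ++ [(2 : Fin 3)])
  else f x

/-- Graft the tree `s` at the positions of `l` and of `l'` that lie on the side `c`. -/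
def graft2 (t : TTree) (c : Bool) (l l' : NodeId) (s : TTree) : TTree :=
  let t1 := if l.1 = c then t.replaceAt l.2 s else t
  if l'.1 = c then t1.replaceAt l'.2 s else t1

/-- Step A: `Q'` is obtained from `Q` by replacing a pair of paired leaves by a
(1,1)-mini couple. -/
def StepA (Q Q' : Couple) : Prop :=
  ∃ (l : NodeId) (σ : Fin 3 → Fin 3),
    Q.IsLeaf l ∧ (σ = id ∨ σ = swap02) ∧
    Q'.pos = graft2 Q.pos true l (Q.pair l) oneTree ∧
    Q'.neg = graft2 Q.neg false l (Q.pair l) oneTree ∧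
    Q'.pair = normalizePair Q'.pos Q'.neg (stepAPairRaw Q.pair l (Q.pair l) σ)

/-- The relative position (among the grandchildren) of the lone leaf of the mini tree with
parameters `(i, v)`. -/
def loneIdx (i : Fin 3) (v : Bool) : Fin 3 := if i = 1 then 1 else cond v 0 2

/-- The two leaf pairs (as relative positions) of the mini tree with parameters `(i, v)`:
`i` is the index of the child of the root which is a branching node, and `v` selects one of
the two admissible pairings; together `(i, v)` ranges over the six possible mini trees. -/
def bPairs (i : Fin 3) (v : Bool) : (Pos × Pos) × (Pos × Pos) :=
  if i = 1 then
    cond v ((([0], [1, 2]), ([2], [1, 0]))) ((([0], [1, 0]), ([2], [1, 2])))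
  else if i = 0 then
    (([2], [0, 1]), cond v ([1], [0, 2]) ([1], [0, 0]))
  else
    (([0], [2, 1]), cond v ([1], [2, 2]) ([1], [2, 0]))

/-- The branching child of the root of a mini tree: the subtree `S` is reattached at the
lone leaf (grandchild number `lone`). -/
def gchildT (lone : Fin 3) (S : TTree) : TTree :=
  .node (if lone = 0 then S else .leaf) (if lone = 1 then S else .leaf)
    (if lone = 2 then S else .leaf)

/-- The mini tree with branching child in position `i` and the subtree `S` reattached at the
lone leaf (grandchild number `lone`). -/
def miniT (i lone : Fin 3) (S : TTree) : TTree :=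
  .node (if i = 0 then gchildT lone S else .leaf) (if i = 1 then gchildT lone S else .leaf)
    (if i = 2 then gchildT lone S else .leaf)

/-- Relabelling of positions under step B performed at `(c, q)`: nodes below `q` on side `c`
move below the lone leaf `q ++ [i, lone]`. -/
def bump (c : Bool) (q : Pos) (i lone : Fin 3) (x : NodeId) : NodeId :=
  if x.1 = c ∧ q <+: x.2 then (x.1, q ++ i :: lone :: x.2.drop q.length) else x

/-- The new (raw) pairing after step B performed at `(c, q)` with mini tree parameters
`(i, v)`. -/
def stepBPairRaw (f : NodeId → NodeId) (c : Bool) (q : Pos) (i : Fin 3) (v : Bool) :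
    NodeId → NodeId := fun x =>
  if x = (c, q ++ (bPairs i v).1.1) then (c, q ++ (bPairs i v).1.2)
  else if x = (c, q ++ (bPairs i v).1.2) then (c, q ++ (bPairs i v).1.1)
  else if x = (c, q ++ (bPairs i v).2.1) then (c, q ++ (bPairs i v).2.2)
  else if x = (c, q ++ (bPairs i v).2.2) then (c, q ++ (bPairs i v).2.1)
  else if x.1 = c ∧ (q ++ [i, loneIdx i v]) <+: x.2 then
    bump c q i (loneIdx i v) (f (c, q ++ x.2.drop (q.length + 2)))
  else bump c q i (loneIdx i v) (f x)

/-- Step B performed at the node `(c, q)` with mini tree parameters `(i, v)`: the node is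
replaced by a mini tree, the subtree originally rooted there being reattached at the lone
leaf of the mini tree. -/
def StepBAt (Q Q' : Couple) (c : Bool) (q : Pos) (i : Fin 3) (v : Bool) : Prop :=
  ∃ S : TTree, (Q.treeOf c).subtreeAt? q = some S ∧
    Q'.treeOf c = (Q.treeOf c).replaceAt q (miniT i (loneIdx i v) S) ∧
    Q'.treeOf (!c) = Q.treeOf (!c) ∧
    Q'.pair = normalizePair Q'.pos Q'.neg (stepBPairRaw Q.pair c q i v)

/-- Step B: `Q'` is obtained from `Q` by replacing some node by a mini tree. -/
def StepB (Q Q' : Couple) : Prop := ∃ c q i v, StepBAt Q Q' c q i v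

/-- One application of step A or step B. -/
def Step (Q Q' : Couple) : Prop := StepA Q Q' ∨ StepB Q Q'

/-- A regular couple: one obtained from the trivial couple by finitely many applications of
steps A and B. -/
def Regular (Q : Couple) : Prop := Relation.ReflTransGen Step trivialCouple Q

/-- A prime couple: one that cannot be obtained from any other couple by one application of
step A or step B. -/
def IsPrime (Q : Couple) : Prop := ¬ ∃ Q' : Couple, Q' ≠ Q ∧ Step Q' Q

/-- `Qsk` is a skeleton of `Q`: it is prime and `Q` is obtained from it by finitely many
applications of steps A and B. -/
def HasSkeleton (Q Qsk : Couple) : Prop :=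
  IsPrime Qsk ∧ Relation.ReflTransGen Step Qsk Q

/-! ### Proof: names for leaves

Each reachable couple is described by its two trees with a finite amount of data on each edge.
The data computes a name for every leaf, and two leaves are paired iff their names agree. -/

/-- The instruction carried by an edge of a tree. -/
inductive Instr : Type where
  | ext : Instr
  | push : Fin 3 → Instr
  | enter : Instr
  | pop : Instr
  | new : Fin 3 → Instr
  deriving DecidableEq, Fintype

/-- The origin of a name: a skeleton node or the root of a mini tree. -/
inductive Origin : Type where
  | skel : NodeId → Origin
  | fresh : NodeId → Origin

/-- A state: the current name and a stack of names. -/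
abbrev St : Type := (Origin × Pos) × List (Origin × Pos)

/-- Execute the instruction on the edge from `cur` to its child number `k`. -/
def Instr.run : Instr → NodeId → Fin 3 → St → St
  | .ext, _, k, ((.skel p, w), s) => ((.skel (p.1, p.2 ++ [k]), w), s)
  | .ext, _, _, s => s
  | .push a, _, _, ((o, w), s) => ((o, w ++ [a]), s)
  | .enter, cur, _, (h, s) => ((.fresh cur, []), h :: s)
  | .pop, _, _, (h, []) => (h, [])
  | .pop, _, _, (_, h :: s) => (h, s)
  | .new a, cur, _, (h, s) => ((.fresh cur, [a]), h :: s)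

/-- Auxiliary: the state at a reversed position. -/
def stR (lam : NodeId → Instr) (c : Bool) : Pos → St
  | [] => ((.skel (c, []), []), [])
  | k :: r => (lam (c, (k :: r).reverse)).run (c, r.reverse) k (stR lam c r)

/-- The state at a node. -/
def st (lam : NodeId → Instr) (x : NodeId) : St := stR lam x.1 x.2.reverse

theorem st_nil (lam : NodeId → Instr) (c : Bool) :
    st lam (c, []) = ((.skel (c, []), []), []) := rfl

theorem st_snoc (lam : NodeId → Instr) (c : Bool) (p : Pos) (k : Fin 3) :
    st lam (c, p ++ [k]) = (lam (c, p ++ [k])).run (c, p) k (st lam (c, p)) := by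
  simp [st, stR]

/-- Origins up to exchanging the members of a leaf pair of the skeleton. -/
def canon (f : NodeId → NodeId) : Origin → Sym2 NodeId ⊕ NodeId
  | .skel p => .inl s(p, f p)
  | .fresh x => .inr x

/-- The instructions `lam` describe the pairing of `Q`. -/
def Inv (f : NodeId → NodeId) (Q : Couple) (lam : NodeId → Instr) : Prop :=
  (∀ x, Q.IsLeaf x →
    canon f (st lam x).1.1 = canon f (st lam (Q.pair x)).1.1 ∧
      (st lam x).1.2 = (st lam (Q.pair x)).1.2) ∧
  ∀ x y, Q.IsLeaf x → Q.IsLeaf y → canon f (st lam x).1.1 = canon f (st lam y).1.1 →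
    (st lam x).1.2 <+: (st lam y).1.2 → y = x ∨ y = Q.pair x

theorem Couple.isLeaf_pair {Q : Couple} {x : NodeId} (h : Q.IsLeaf x) : Q.IsLeaf (Q.pair x) :=
  Q.pair_leaf x h

theorem couple_ext {Q Q' : Couple} (h1 : Q.pos = Q'.pos) (h2 : Q.neg = Q'.neg)
    (h3 : ∀ x, Q.IsLeaf x → Q.pair x = Q'.pair x) : Q = Q' := by
  have h4 : Q.pair = Q'.pair := by
    funext x
    by_cases hx : Q.IsLeaf x
    · exact h3 x hx
    · rw [Q.pair_norm x hx, Q'.pair_norm x (by rw [← h1, ← h2]; exact hx)]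
  cases Q; cases Q'; simp_all

theorem inv_unique {f : NodeId → NodeId} {Q Q' : Couple} {lam lam' : NodeId → Instr}
    (h : Inv f Q lam) (h' : Inv f Q' lam') (h1 : Q.pos = Q'.pos) (h2 : Q.neg = Q'.neg)
    (hst : ∀ x, Q.IsLeaf x → st lam x = st lam' x) : Q = Q' := by
  have hl : ∀ x, Q.IsLeaf x → Q'.IsLeaf x := by
    intro x hx
    unfold Couple.IsLeaf Couple.treeOf at *
    rwa [← h1, ← h2]
  apply couple_ext h1 h2
  intro x hx
  have hy := Couple.isLeaf_pair hx
  have e := h.1 x hx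
  rw [hst x hx, hst _ hy] at e
  rcases h'.2 x (Q.pair x) (hl _ hx) (hl _ hy) e.1 (by rw [e.2]) with h | h
  · exact absurd h (Q.pair_ne x hx)
  · exact h

theorem st_ext_all (c : Bool) (p : Pos) :
    st (fun _ => Instr.ext) (c, p) = ((.skel (c, p), []), []) := by
  induction p using List.reverseRecOn with
  | nil => rfl
  | append_singleton p k ih => rw [st_snoc, ih]; rfl

theorem inv_init (Q : Couple) : Inv Q.pair Q (fun _ => Instr.ext) := by
  constructor
  · rintro ⟨c, p⟩ hx
    have h := Q.pair_invol _ hx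
    rcases hp : Q.pair (c, p) with ⟨c', p'⟩
    rw [hp] at h
    simp only [st_ext_all, canon, hp, h, and_true]
    rw [Sym2.eq_swap]
  · rintro ⟨c, p⟩ ⟨c', p'⟩ hx hy h1 h2
    simp only [st_ext_all, canon, Sum.inl.injEq, Sym2.eq_iff] at h1
    rcases h1 with h | h
    · exact Or.inl h.1.symm
    · exact Or.inr h.2.symm

/-! ### Trees and positions -/

theorem subtreeAt?_node (a b c : TTree) (k : Fin 3) (p : Pos) :
    (TTree.node a b c).subtreeAt? (k :: p) =
      (if k = 0 then a else if k = 1 then b else c).subtreeAt? p := by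
  fin_cases k <;> rfl

theorem subtreeAt?_append (t : TTree) (p q : Pos) :
    t.subtreeAt? (p ++ q) = (t.subtreeAt? p).bind (fun s => s.subtreeAt? q) := by
  induction p generalizing t with
  | nil => cases t <;> simp [TTree.subtreeAt?]
  | cons k p ih =>
    cases t with
    | leaf => simp [TTree.subtreeAt?]
    | node a b c => rw [List.cons_append, subtreeAt?_node, subtreeAt?_node, ih]

theorem leaf_replaceAt (t s : TTree) (p x : Pos) (h : (t.replaceAt p s).IsLeafPos x) :
    (∃ r, x = p ++ r ∧ s.IsLeafPos r) ∨ (t.IsLeafPos x ∧ ¬ p <+: x) := by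
  induction p generalizing t x with
  | nil =>
    left
    have : t.replaceAt [] s = s := by cases t <;> rfl
    rw [this] at h
    exact ⟨x, rfl, h⟩
  | cons k p ih =>
    cases t with
    | leaf =>
      right
      have : TTree.leaf.replaceAt (k :: p) s = .leaf := rfl
      rw [this] at h
      refine ⟨h, ?_⟩
      rw [isLeafPos_leaf_iff] at h
      simp [h]
    | node a b c =>
      cases x with
      | nil =>
        exfalso
        fin_cases k <;> simp [TTree.IsLeafPos, TTree.replaceAt, TTree.subtreeAt?] at h
      | cons j x =>
        have key : ∀ j k : Fin 3, ((TTree.node a b c).replaceAt (k :: p) s).subtreeAt? (j :: x) =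
            if j = k then ((if k = 0 then a else if k = 1 then b else c).replaceAt p s).subtreeAt? x
            else (TTree.node a b c).subtreeAt? (j :: x) := by
          intro j k
          fin_cases k <;> fin_cases j <;> rfl
        unfold TTree.IsLeafPos at h
        rw [key] at h
        by_cases hjk : j = k
        · subst hjk
          rw [if_pos rfl] at h
          rcases ih _ _ h with ⟨r, hr, hs⟩ | ⟨h1, h2⟩
          · exact Or.inl ⟨r, by simp [hr], hs⟩
          · right
            refine ⟨?_, by simpa using h2⟩
            unfold TTree.IsLeafPos
            rw [subtreeAt?_node]
            exact h1
        · rw [if_neg hjk] at h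
          right
          refine ⟨h, ?_⟩
          simp [List.cons_prefix_cons, Ne.symm hjk]

theorem leaf_oneTree {r : Pos} (h : oneTree.IsLeafPos r) : ∃ k, r = [k] := by
  cases r with
  | nil => simp [TTree.IsLeafPos, oneTree, TTree.subtreeAt?] at h
  | cons k r =>
    refine ⟨k, ?_⟩
    unfold TTree.IsLeafPos oneTree at h
    rw [subtreeAt?_node] at h
    simp only [ite_self] at h
    rw [(isLeafPos_leaf_iff r).mp h]

theorem leaf_graft2 (t : TTree) (c : Bool) (l l' : NodeId) (x : Pos)
    (h : (graft2 t c l l' oneTree).IsLeafPos x) :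
    (∃ k, (c, x) = (l.1, l.2 ++ [k])) ∨ (∃ k, (c, x) = (l'.1, l'.2 ++ [k])) ∨
      (t.IsLeafPos x ∧ (c, x) ≠ l ∧ (c, x) ≠ l') := by
  have h1 : (∃ k, (c, x) = (l'.1, l'.2 ++ [k])) ∨
      ((if l.1 = c then t.replaceAt l.2 oneTree else t).IsLeafPos x ∧ (c, x) ≠ l') := by
    unfold graft2 at h
    by_cases hc : l'.1 = c
    · simp only [if_pos hc] at h
      rcases leaf_replaceAt _ _ _ _ h with ⟨r, hr, hs⟩ | ⟨h1, h2⟩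
      · obtain ⟨k, rfl⟩ := leaf_oneTree hs
        exact Or.inl ⟨k, by rw [hc, hr]⟩
      · refine Or.inr ⟨h1, ?_⟩
        rintro rfl
        simp at h2
    · simp only [if_neg hc] at h
      refine Or.inr ⟨h, ?_⟩
      rintro rfl
      simp at hc
  rcases h1 with h1 | ⟨h, h1⟩
  · exact Or.inr (Or.inl h1)
  by_cases hc : l.1 = c
  · simp only [if_pos hc] at h
    rcases leaf_replaceAt _ _ _ _ h with ⟨r, hr, hs⟩ | ⟨h3, h2⟩
    · obtain ⟨k, rfl⟩ := leaf_oneTree hs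
      exact Or.inl ⟨k, by rw [hc, hr]⟩
    · refine Or.inr (Or.inr ⟨h3, ?_, h1⟩)
      rintro rfl
      simp at h2
  · simp only [if_neg hc] at h
    refine Or.inr (Or.inr ⟨h, ?_, h1⟩)
    rintro rfl
    simp at hc

theorem not_leaf_child {Q : Couple} {l : NodeId} (h : Q.IsLeaf l) (r : Pos) (k : Fin 3) :
    ((Q.treeOf l.1).subtreeAt? (l.2 ++ k :: r)) = none := by
  unfold Couple.IsLeaf TTree.IsLeafPos at h
  rw [subtreeAt?_append, h]
  rfl

/-! ### Step A -/

/-- The instructions after step A. -/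
def lamA (lam : NodeId → Instr) (l l' : NodeId) (σ : Fin 3 → Fin 3) : NodeId → Instr := fun y =>
  match y.2.getLast? with
  | none => lam y
  | some k =>
    if (y.1, y.2.dropLast) = l then .push k
    else if (y.1, y.2.dropLast) = l' then .push (σ k) else lam y

theorem lamA_snoc (lam : NodeId → Instr) (l l' : NodeId) (σ : Fin 3 → Fin 3) (c : Bool) (p : Pos)
    (k : Fin 3) : lamA lam l l' σ (c, p ++ [k]) =
      if (c, p) = l then .push k else if (c, p) = l' then .push (σ k) else lam (c, p ++ [k]) := by
  simp [lamA]

theorem isSome_of_snoc {t : TTree} {p : Pos} {r : Pos} (h : (t.subtreeAt? (p ++ r)).isSome) :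
    (t.subtreeAt? p).isSome := by
  rw [subtreeAt?_append] at h
  cases h' : t.subtreeAt? p with
  | none => simp [h'] at h
  | some _ => rfl

theorem st_lamA (Q : Couple) (lam : NodeId → Instr) (l l' : NodeId) (σ : Fin 3 → Fin 3)
    (hl : Q.IsLeaf l) (hl' : Q.IsLeaf l') (c : Bool) (p : Pos)
    (h : ((Q.treeOf c).subtreeAt? p).isSome) :
    st (lamA lam l l' σ) (c, p) = st lam (c, p) := by
  induction p using List.reverseRecOn with
  | nil => rfl
  | append_singleton p k ih =>
    rw [st_snoc, st_snoc, ih (isSome_of_snoc h), lamA_snoc, if_neg, if_neg]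
    · rintro rfl
      have := not_leaf_child hl' [] k
      simp [this] at h
    · rintro rfl
      have := not_leaf_child hl [] k
      simp [this] at h

theorem st_lamA_leaf {Q : Couple} (lam : NodeId → Instr) {l l' : NodeId} (σ : Fin 3 → Fin 3)
    (hl : Q.IsLeaf l) (hl' : Q.IsLeaf l') {x : NodeId} (h : Q.IsLeaf x) :
    st (lamA lam l l' σ) x = st lam x :=
  st_lamA Q lam l l' σ hl hl' x.1 x.2 (by
    unfold Couple.IsLeaf TTree.IsLeafPos at h
    rw [h]; rfl)

theorem inv_stepA {f : NodeId → NodeId} {Q Q' : Couple} {lam : NodeId → Instr}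
    (h : Inv f Q lam) (hs : StepA Q Q') : ∃ lam', Inv f Q' lam' := by
  obtain ⟨l, σ, hl, hσ, hp, hn, hpair⟩ := hs
  have hl' := Couple.isLeaf_pair hl
  have hne := Q.pair_ne l hl
  have hinv := Q.pair_invol l hl
  obtain ⟨nm1, nm2⟩ := h.1 l hl
  obtain ⟨h1, h2⟩ := h
  generalize hl'e : Q.pair l = l' at *
  have hσσ : ∀ k, σ (σ k) = k := by
    rcases hσ with rfl | rfl <;> decide
  have hleaf : ∀ x, Q'.IsLeaf x → (∃ k, x = (l.1, l.2 ++ [k])) ∨ (∃ k, x = (l'.1, l'.2 ++ [k])) ∨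
      (Q.IsLeaf x ∧ x ≠ l ∧ x ≠ l') := by
    rintro ⟨c, x⟩ hx
    unfold Couple.IsLeaf Couple.treeOf at hx
    cases c
    · simp only [cond_false, hn] at hx
      exact leaf_graft2 _ _ _ _ _ hx
    · simp only [cond_true, hp] at hx
      exact leaf_graft2 _ _ _ _ _ hx
  have hraw : ∀ x, Q'.IsLeaf x → Q'.pair x = stepAPairRaw Q.pair l l' σ x := by
    intro x hx
    rw [hpair]
    exact if_pos hx
  have hch : ∀ k, ∀ m, Q.IsLeaf m → ¬ Q.IsLeaf (m.1, m.2 ++ [k]) := by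
    intro k m hm hk
    have := not_leaf_child hm [] k
    unfold Couple.IsLeaf TTree.IsLeafPos at hk
    rw [this] at hk
    simp at hk
  have hneq : ∀ j k, ((l.1, l.2 ++ [j]) : NodeId) ≠ (l'.1, l'.2 ++ [k]) := by
    intro j k e
    apply hne
    simp only [Prod.mk.injEq] at e
    have := List.append_inj' e.2 rfl
    exact (Prod.ext e.1 this.1).symm
  have raw1 : ∀ k, stepAPairRaw Q.pair l l' σ (l.1, l.2 ++ [k]) = (l'.1, l'.2 ++ [σ k]) := by
    intro k
    fin_cases k <;> simp [stepAPairRaw]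
  have raw2 : ∀ k, stepAPairRaw Q.pair l l' σ (l'.1, l'.2 ++ [k]) = (l.1, l.2 ++ [σ k]) := by
    intro k
    have hn' : ∀ j k, ¬ ((l'.1, l'.2 ++ [k]) : NodeId) = (l.1, l.2 ++ [j]) :=
      fun j k e => hneq j k e.symm
    unfold stepAPairRaw
    rw [if_neg (hn' _ _), if_neg (hn' _ _), if_neg (hn' _ _)]
    rcases hσ with rfl | rfl <;> fin_cases k <;> simp [swap02]
  have raw3 : ∀ x, Q.IsLeaf x → stepAPairRaw Q.pair l l' σ x = Q.pair x := by
    intro x hx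
    have a1 : ∀ k, ¬ x = (l.1, l.2 ++ [k]) := fun k e => hch k l hl (e ▸ hx)
    have a2 : ∀ k, ¬ x = (l'.1, l'.2 ++ [k]) := fun k e => hch k l' hl' (e ▸ hx)
    simp only [stepAPairRaw, a1, a2, if_false]
  have st1 : ∀ k, st (lamA lam l l' σ) (l.1, l.2 ++ [k]) =
      (((st lam l).1.1, (st lam l).1.2 ++ [k]), (st lam l).2) := by
    intro k
    rw [st_snoc, lamA_snoc, if_pos rfl]
    rw [show st (lamA lam l l' σ) (l.1, l.2) = st lam l from st_lamA_leaf lam σ hl hl' hl]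
    rfl
  have st2 : ∀ k, st (lamA lam l l' σ) (l'.1, l'.2 ++ [k]) =
      (((st lam l').1.1, (st lam l').1.2 ++ [σ k]), (st lam l').2) := by
    intro k
    rw [st_snoc, lamA_snoc, if_neg hne, if_pos rfl]
    rw [show st (lamA lam l l' σ) (l'.1, l'.2) = st lam l' from st_lamA_leaf lam σ hl hl' hl']
    rfl
  have st3 : ∀ x, Q.IsLeaf x → st (lamA lam l l' σ) x = st lam x :=
    fun x hx => st_lamA_leaf lam σ hl hl' hx
  have hnew : ∀ x k, (x = (l.1, l.2 ++ [k]) ∨ x = (l'.1, l'.2 ++ [σ k])) →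
      canon f (st (lamA lam l l' σ) x).1.1 = canon f (st lam l).1.1 ∧
      (st (lamA lam l l' σ) x).1.2 = (st lam l).1.2 ++ [k] := by
    rintro x k (rfl | rfl)
    · rw [st1]; exact ⟨rfl, rfl⟩
    · rw [st2, hσσ]
      exact ⟨nm1.symm, by rw [nm2]⟩
  have hleaf' : ∀ x, Q'.IsLeaf x → (∃ k, x = (l.1, l.2 ++ [k]) ∨ x = (l'.1, l'.2 ++ [σ k])) ∨
      (Q.IsLeaf x ∧ x ≠ l ∧ x ≠ l') := by
    intro x hx
    rcases hleaf x hx with ⟨k, hk⟩ | ⟨k, hk⟩ | hk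
    · exact Or.inl ⟨k, Or.inl hk⟩
    · exact Or.inl ⟨σ k, Or.inr (by rw [hσσ]; exact hk)⟩
    · exact Or.inr hk
  refine ⟨lamA lam l l' σ, ?_, ?_⟩
  · intro x hx
    rw [hraw x hx]
    rcases hleaf' x hx with ⟨k, hk⟩ | ⟨hk, -, -⟩
    · have a := hnew x k hk
      have b := hnew (stepAPairRaw Q.pair l l' σ x) k (by
        rcases hk with rfl | rfl
        · right; rw [raw1]
        · left; rw [raw2, hσσ])
      exact ⟨a.1.trans b.1.symm, a.2.trans b.2.symm⟩
    · rw [raw3 x hk, st3 x hk, st3 _ (Couple.isLeaf_pair hk)]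
      exact h1 x hk
  · intro x y hx hy e1 e2
    rw [hraw x hx]
    rcases hleaf' x hx with ⟨k, hk⟩ | ⟨hk, hk1, hk2⟩ <;>
      rcases hleaf' y hy with ⟨j, hj⟩ | ⟨hj, hj1, hj2⟩
    · have a := hnew x k hk
      have b := hnew y j hj
      rw [a.2, b.2] at e2
      have e3 : k = j := by simpa using e2.eq_of_length (by simp)
      subst e3
      rcases hk with rfl | rfl <;> rcases hj with rfl | rfl
      · exact Or.inl rfl
      · right; rw [raw1]
      · right; rw [raw2, hσσ]
      · exact Or.inl rfl
    · exfalso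
      have a := hnew x k hk
      rw [a.2, st3 y hj] at e2
      rw [a.1, st3 y hj] at e1
      rcases h2 l y hl hj e1 ((List.prefix_append _ _).trans e2) with e | e
      · exact hj1 e
      · exact hj2 (e.trans hl'e)
    · exfalso
      have b := hnew y j hj
      rw [b.2, st3 x hk] at e2
      rw [b.1, st3 x hk] at e1
      rcases List.prefix_concat_iff.mp e2 with e2 | e2
      · rcases h2 l x hl hk e1.symm (by rw [e2]; exact List.prefix_append _ _) with e | e
        · exact hk1 e
        · exact hk2 (e.trans hl'e)
      · rcases h2 x l hk hl e1 e2 with e | e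
        · exact hk1 e.symm
        · have := Q.pair_invol x hk
          rw [← e, hl'e] at this
          exact hk2 this.symm
    · rw [raw3 x hk]
      rw [st3 x hk, st3 y hj] at e1 e2
      exact h2 x y hk hj e1 e2

/-! ### Step B -/

/-- Rename the positions in a name. -/
def renN (g : NodeId → NodeId) : Origin × Pos → Origin × Pos
  | (.skel p, w) => (.skel p, w)
  | (.fresh x, w) => (.fresh (g x), w)

/-- Rename the positions in a state. -/
def renS (g : NodeId → NodeId) (s : St) : St := (renN g s.1, s.2.map (renN g))

theorem run_ren (g : NodeId → NodeId) (ins : Instr) (cur : NodeId) (k : Fin 3) (s : St) :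
    ins.run (g cur) k (renS g s) = renS g (ins.run cur k s) := by
  obtain ⟨⟨o, w⟩, s⟩ := s
  cases ins <;> cases o <;> cases s <;> rfl

/-- Instruction on the edges at the root of a mini tree. -/
def lab1 (i : Fin 3) (v : Bool) (k : Fin 3) : Instr :=
  if k = i then .enter else if [k] = (bPairs i v).1.1 then .new 0 else .new 1

/-- Instruction on the edges at the branching child of a mini tree. -/
def lab2 (i : Fin 3) (v : Bool) (k : Fin 3) : Instr :=
  if k = loneIdx i v then .pop else if [i, k] = (bPairs i v).1.2 then .push 0 else .push 1

/-- Instructions after step B, relative to the node `(c, q)`. -/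
def lamBrel (lam : NodeId → Instr) (c : Bool) (q : Pos) (i : Fin 3) (v : Bool) : Pos → Instr
  | [] => lam (c, q)
  | [k] => lab1 i v k
  | [_, k] => lab2 i v k
  | _ :: _ :: r => lam (c, q ++ r)

/-- The instructions after step B. -/
def lamB (lam : NodeId → Instr) (c : Bool) (q : Pos) (i : Fin 3) (v : Bool) : NodeId → Instr :=
  fun y => if y.1 = c ∧ q <+: y.2 then lamBrel lam c q i v (y.2.drop q.length) else lam y

theorem lamB_append (lam : NodeId → Instr) (c : Bool) (q : Pos) (i : Fin 3) (v : Bool) (r : Pos) :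
    lamB lam c q i v (c, q ++ r) = lamBrel lam c q i v r := by
  simp [lamB]

theorem bump_append (c : Bool) (q : Pos) (i lone : Fin 3) (r : Pos) :
    bump c q i lone (c, q ++ r) = (c, q ++ i :: lone :: r) := by
  simp [bump]

theorem bump_not {c : Bool} {q : Pos} {i lone : Fin 3} {x : NodeId}
    (h : ¬ (x.1 = c ∧ q <+: x.2)) : bump c q i lone x = x := if_neg h

theorem st_lamB_not (lam : NodeId → Instr) (c : Bool) (q : Pos) (i : Fin 3) (v : Bool)
    (d : Bool) (p : Pos) (h : ¬ (d = c ∧ q <+: p)) :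
    st (lamB lam c q i v) (d, p) = renS (bump c q i (loneIdx i v)) (st lam (d, p)) := by
  induction p using List.reverseRecOn with
  | nil => rfl
  | append_singleton p k ih =>
    have h' : ¬ (d = c ∧ q <+: p) := fun e => h ⟨e.1, e.2.trans (List.prefix_append _ _)⟩
    have e : lamB lam c q i v (d, p ++ [k]) = lam (d, p ++ [k]) := if_neg h
    rw [st_snoc, st_snoc, ih h', e, ← run_ren, bump_not (x := (d, p)) h']

theorem st_lamB_self (lam : NodeId → Instr) (c : Bool) (q : Pos) (i : Fin 3) (v : Bool) :
    st (lamB lam c q i v) (c, q) = renS (bump c q i (loneIdx i v)) (st lam (c, q)) := by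
  rcases List.eq_nil_or_concat q with h | ⟨p, k, h⟩
  · subst h; rfl
  · rw [List.concat_eq_append] at h
    have h' : ¬ (c = c ∧ q <+: p) := by
      rintro ⟨-, e⟩
      have := e.length_le
      rw [h] at this
      simp at this
    have e : lamB lam c q i v (c, q) = lam (c, q) := by
      have := lamB_append lam c q i v []
      rw [List.append_nil] at this
      exact this
    have e1 : st lam (c, q) = (lam (c, q)).run (c, p) k (st lam (c, p)) := by
      rw [h]; exact st_snoc _ _ _ _
    have e2 : st (lamB lam c q i v) (c, q) =
        (lamB lam c q i v (c, q)).run (c, p) k (st (lamB lam c q i v) (c, p)) := by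
      conv_lhs => rw [h]
      conv_rhs => rw [h]
      rw [st_snoc, ← h]
    rw [e1, e2, e, st_lamB_not _ _ _ _ _ _ _ h', ← run_ren, bump_not (x := (c, p)) h']

theorem st_lamB_one (lam : NodeId → Instr) (c : Bool) (q : Pos) (i : Fin 3) (v : Bool) (k : Fin 3) :
    st (lamB lam c q i v) (c, q ++ [k]) =
      (lab1 i v k).run (c, q) k (st (lamB lam c q i v) (c, q)) := by
  rw [st_snoc, lamB_append]
  rfl

theorem st_lamB_two (lam : NodeId → Instr) (c : Bool) (q : Pos) (i : Fin 3) (v : Bool)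
    (j k : Fin 3) :
    st (lamB lam c q i v) (c, q ++ [j, k]) =
      (lab2 i v k).run (c, q ++ [j]) k (st (lamB lam c q i v) (c, q ++ [j])) := by
  have : q ++ [j, k] = (q ++ [j]) ++ [k] := by simp
  rw [this, st_snoc, ← this, lamB_append]
  rfl

theorem st_lamB_below (lam : NodeId → Instr) (c : Bool) (q : Pos) (i : Fin 3) (v : Bool) (r : Pos) :
    st (lamB lam c q i v) (c, q ++ i :: loneIdx i v :: r) =
      renS (bump c q i (loneIdx i v)) (st lam (c, q ++ r)) := by
  induction r using List.reverseRecOn with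
  | nil =>
    rw [st_lamB_two, st_lamB_one, st_lamB_self]
    simp only [lab1, lab2, if_true, List.append_nil]
    rfl
  | append_singleton r k ih =>
    have e1 : q ++ i :: loneIdx i v :: (r ++ [k]) = (q ++ i :: loneIdx i v :: r) ++ [k] := by simp
    have e2 : q ++ (r ++ [k]) = (q ++ r) ++ [k] := by simp
    have e3 : lamB lam c q i v (c, q ++ i :: loneIdx i v :: (r ++ [k])) = lam (c, q ++ (r ++ [k])) := by
      rw [lamB_append]
      cases r <;> rfl
    rw [e1, st_snoc, ← e1, e3, ih, e2, st_snoc, ← run_ren, bump_append]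

theorem st_lamB_bump (lam : NodeId → Instr) (c : Bool) (q : Pos) (i : Fin 3) (v : Bool)
    (x : NodeId) :
    st (lamB lam c q i v) (bump c q i (loneIdx i v) x) =
      renS (bump c q i (loneIdx i v)) (st lam x) := by
  by_cases h : x.1 = c ∧ q <+: x.2
  · obtain ⟨d, p⟩ := x
    obtain ⟨h1, r, h2⟩ := h
    dsimp only at h1 h2
    subst h1 h2
    rw [bump_append, st_lamB_below]
  · rw [bump_not h, st_lamB_not _ _ _ _ _ _ _ h]

theorem bump_inj (c : Bool) (q : Pos) (i lone : Fin 3) :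
    Function.Injective (bump c q i lone) := by
  have hb : ∀ x : NodeId, (bump c q i lone x = x ∧ ¬ (x.1 = c ∧ q <+: x.2)) ∨
      ∃ r, x = (c, q ++ r) ∧ bump c q i lone x = (c, q ++ i :: lone :: r) := by
    rintro ⟨d, p⟩
    by_cases h : d = c ∧ q <+: p
    · obtain ⟨rfl, r, rfl⟩ := h
      exact Or.inr ⟨r, rfl, bump_append _ _ _ _ _⟩
    · exact Or.inl ⟨bump_not h, h⟩
  intro x y h
  rcases hb x with ⟨h1, h2⟩ | ⟨r, h1, h2⟩ <;> rcases hb y with ⟨h3, h4⟩ | ⟨s, h3, h4⟩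
  · rw [← h1, h, h3]
  · exfalso; apply h2; rw [← h1, h, h4]; exact ⟨rfl, List.prefix_append _ _⟩
  · exfalso; apply h4; rw [← h3, ← h, h2]; exact ⟨rfl, List.prefix_append _ _⟩
  · rw [h2, h4] at h
    rw [h1, h3]
    simpa using h

theorem bump_ne_self (c : Bool) (q : Pos) (i lone : Fin 3) (x : NodeId) :
    bump c q i lone x ≠ (c, q) := by
  intro h
  by_cases hx : x.1 = c ∧ q <+: x.2
  · have := congrArg (fun z : NodeId => z.2.length) h
    simp [bump, hx] at this
  · rw [bump_not hx] at h
    subst h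
    exact hx ⟨rfl, List.prefix_rfl⟩

theorem canon_renN (f g : NodeId → NodeId) (a : Origin × Pos) :
    canon f (renN g a).1 = Sum.map id g (canon f a.1) := by
  obtain ⟨o, w⟩ := a
  cases o <;> rfl

theorem renN_snd (g : NodeId → NodeId) (a : Origin × Pos) : (renN g a).2 = a.2 := by
  obtain ⟨o, w⟩ := a
  cases o <;> rfl

theorem map_bump_ne (c : Bool) (q : Pos) (i lone : Fin 3) (u : Sym2 NodeId ⊕ NodeId) :
    Sum.map id (bump c q i lone) u ≠ .inr (c, q) := by
  cases u with
  | inl z => simp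
  | inr z =>
    intro h
    exact bump_ne_self c q i lone z (Sum.inr.inj h)

/-- The four new leaves of a mini tree, in two pairs. -/
def IsNewRel (i : Fin 3) (v : Bool) (a : Fin 3) (r : Pos) : Prop :=
  (a = 0 ∧ (r = (bPairs i v).1.1 ∨ r = (bPairs i v).1.2)) ∨
    (a = 1 ∧ (r = (bPairs i v).2.1 ∨ r = (bPairs i v).2.2))

theorem leaf_miniT (i : Fin 3) (v : Bool) (S : TTree) (r : Pos)
    (h : (miniT i (loneIdx i v) S).IsLeafPos r) :
    (∃ a, IsNewRel i v a r) ∨ ∃ r', r = i :: loneIdx i v :: r' ∧ S.IsLeafPos r' := by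
  unfold TTree.IsLeafPos at h
  cases r with
  | nil => simp [miniT, TTree.subtreeAt?] at h
  | cons k r =>
    unfold miniT at h
    rw [subtreeAt?_node] at h
    by_cases hk : k = i
    · subst hk
      have h' : (gchildT (loneIdx k v) S).subtreeAt? r = some .leaf := by
        fin_cases k <;> simpa using h
      cases r with
      | nil => simp [gchildT, TTree.subtreeAt?] at h'
      | cons j r =>
        unfold gchildT at h'
        rw [subtreeAt?_node] at h'
        by_cases hj : j = loneIdx k v
        · right
          refine ⟨r, by rw [hj], ?_⟩
          unfold TTree.IsLeafPos
          rw [← h']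
          congr 1
          rw [← hj]
          fin_cases j <;> rfl
        · left
          have h2 : TTree.leaf.subtreeAt? r = some .leaf := by
            rw [← h']
            congr 1
            revert hj
            generalize loneIdx k v = m
            fin_cases j <;> fin_cases m <;> simp
          rw [(isLeafPos_leaf_iff r).mp h2]
          clear h h' h2
          revert hj
          unfold IsNewRel
          revert k v j
          decide
    · left
      have h2 : TTree.leaf.subtreeAt? r = some .leaf := by
        rw [← h]
        congr 1
        revert hk
        fin_cases k <;> fin_cases i <;> simp
      rw [(isLeafPos_leaf_iff r).mp h2]
      clear h h2
      revert hk
      unfold IsNewRel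
      revert k i v
      decide

theorem newRel_cases {i : Fin 3} {v : Bool} {a : Fin 3} {r : Pos} (h : IsNewRel i v a r) :
    (∃ k, r = [k] ∧ lab1 i v k = .new a) ∨ (∃ k, r = [i, k] ∧ lab2 i v k = .push a) := by
  rcases h with ⟨rfl, rfl | rfl⟩ | ⟨rfl, rfl | rfl⟩
  · left; revert i v; decide
  · right; revert i v; decide
  · left; revert i v; decide
  · right; revert i v; decide

theorem st_newRel (lam : NodeId → Instr) (c : Bool) (q : Pos) {i : Fin 3} {v : Bool} {a : Fin 3}
    {r : Pos} (h : IsNewRel i v a r) :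
    (st (lamB lam c q i v) (c, q ++ r)).1 = (.fresh (c, q), [a]) := by
  rcases newRel_cases h with ⟨k, rfl, hk⟩ | ⟨k, rfl, hk⟩
  · rw [st_lamB_one, hk]; rfl
  · rw [st_lamB_two, hk, st_lamB_one]
    simp only [lab1, if_true]
    rfl

theorem raw_newRel (f : NodeId → NodeId) (c : Bool) (q : Pos) {i : Fin 3} {v : Bool} {a : Fin 3}
    {r : Pos} (h : IsNewRel i v a r) :
    ∃ r', stepBPairRaw f c q i v (c, q ++ r) = (c, q ++ r') ∧ IsNewRel i v a r' ∧
      ∀ s, IsNewRel i v a s → s = r ∨ s = r' := by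
  have d1 : ¬ (bPairs i v).1.2 = (bPairs i v).1.1 := by clear * -; revert i v; decide
  have d2 : ¬ (bPairs i v).2.1 = (bPairs i v).1.1 := by clear * -; revert i v; decide
  have d3 : ¬ (bPairs i v).2.1 = (bPairs i v).1.2 := by clear * -; revert i v; decide
  have d4 : ¬ (bPairs i v).2.2 = (bPairs i v).1.1 := by clear * -; revert i v; decide
  have d5 : ¬ (bPairs i v).2.2 = (bPairs i v).1.2 := by clear * -; revert i v; decide
  have d6 : ¬ (bPairs i v).2.2 = (bPairs i v).2.1 := by clear * -; revert i v; decide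
  rcases h with ⟨rfl, rfl | rfl⟩ | ⟨rfl, rfl | rfl⟩
  · exact ⟨(bPairs i v).1.2, by simp [stepBPairRaw], by simp [IsNewRel], by simp [IsNewRel]⟩
  · exact ⟨(bPairs i v).1.1, by simp [stepBPairRaw, d1], by simp [IsNewRel],
      by simp [IsNewRel]⟩
  · exact ⟨(bPairs i v).2.2, by simp [stepBPairRaw, d2, d3], by simp [IsNewRel], by simp [IsNewRel]⟩
  · exact ⟨(bPairs i v).2.1, by simp [stepBPairRaw, d4, d5, d6], by simp [IsNewRel],
      by simp [IsNewRel]⟩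

theorem raw_bump (f : NodeId → NodeId) (c : Bool) (q : Pos) (i : Fin 3) (v : Bool) (x : NodeId) :
    stepBPairRaw f c q i v (bump c q i (loneIdx i v) x) = bump c q i (loneIdx i v) (f x) := by
  by_cases h : x.1 = c ∧ q <+: x.2
  · obtain ⟨d, p⟩ := x
    obtain ⟨h1, r, h2⟩ := h
    dsimp only at h1 h2
    subst h1 h2
    rw [bump_append]
    have key : ∀ s : Pos, (s = (bPairs i v).1.1 ∨ s = (bPairs i v).1.2 ∨ s = (bPairs i v).2.1 ∨
        s = (bPairs i v).2.2) → ¬ ((d, q ++ i :: loneIdx i v :: r) : NodeId) = (d, q ++ s) := by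
      intro s hs e
      have e' : i :: loneIdx i v :: r = s := by simpa using e
      have hh : s.take 2 ≠ [i, loneIdx i v] := by
        clear e e'
        rcases hs with rfl | rfl | rfl | rfl <;> revert i v <;> decide
      apply hh
      rw [← e']
      rfl
    unfold stepBPairRaw
    rw [if_neg (key _ (by tauto)), if_neg (key _ (by tauto)), if_neg (key _ (by tauto)),
      if_neg (key _ (by tauto)), if_pos]
    · congr 3
      rw [← List.drop_drop]
      simp
    · refine ⟨rfl, r, ?_⟩
      simp
  · rw [bump_not h]
    have key : ∀ s : Pos, ¬ x = (c, q ++ s) := by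
      rintro s rfl
      exact h ⟨rfl, List.prefix_append _ _⟩
    unfold stepBPairRaw
    rw [if_neg (key _), if_neg (key _), if_neg (key _), if_neg (key _), if_neg]
    rintro ⟨h1, h2⟩
    exact h ⟨h1, (List.prefix_append _ _).trans h2⟩

theorem inv_stepB {f : NodeId → NodeId} {Q Q' : Couple} {lam : NodeId → Instr}
    (h : Inv f Q lam) (hs : StepB Q Q') : ∃ lam', Inv f Q' lam' := by
  obtain ⟨c, q, i, v, S, hS, hc, hc', hpair⟩ := hs
  obtain ⟨h1, h2⟩ := h
  have hleaf : ∀ x, Q'.IsLeaf x → (∃ a r, IsNewRel i v a r ∧ x = (c, q ++ r)) ∨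
      ∃ x0, Q.IsLeaf x0 ∧ x = bump c q i (loneIdx i v) x0 := by
    rintro ⟨d, x⟩ hx
    unfold Couple.IsLeaf at hx
    dsimp only at hx
    by_cases hd : d = c
    · subst hd
      rw [hc] at hx
      rcases leaf_replaceAt _ _ _ _ hx with ⟨r, rfl, hr⟩ | ⟨hx1, hx2⟩
      · rcases leaf_miniT _ _ _ _ hr with ⟨a, ha⟩ | ⟨r', rfl, hr'⟩
        · exact Or.inl ⟨a, r, ha, rfl⟩
        · refine Or.inr ⟨(d, q ++ r'), ?_, (bump_append _ _ _ _ _).symm⟩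
          unfold Couple.IsLeaf TTree.IsLeafPos
          rw [subtreeAt?_append, hS]
          exact hr'
      · exact Or.inr ⟨(d, x), hx1, (bump_not (fun e => hx2 e.2)).symm⟩
    · have hd' : d = !c := by cases d <;> cases c <;> simp_all
      refine Or.inr ⟨(d, x), ?_, (bump_not (fun e => hd e.1)).symm⟩
      unfold Couple.IsLeaf
      rw [hd', hc'] at hx
      rw [hd']
      exact hx
  have hraw : ∀ x, Q'.IsLeaf x → Q'.pair x = stepBPairRaw Q.pair c q i v x := by
    intro x hx
    rw [hpair]
    exact if_pos hx
  refine ⟨lamB lam c q i v, ?_, ?_⟩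
  · intro x hx
    rw [hraw x hx]
    rcases hleaf x hx with ⟨a, r, hr, rfl⟩ | ⟨x0, hx0, rfl⟩
    · obtain ⟨r', e, hr', -⟩ := raw_newRel Q.pair c q hr
      rw [e, st_newRel _ _ _ hr, st_newRel _ _ _ hr']
      exact ⟨rfl, rfl⟩
    · rw [raw_bump, st_lamB_bump, st_lamB_bump]
      obtain ⟨a, b⟩ := h1 x0 hx0
      unfold renS
      rw [canon_renN, canon_renN, renN_snd, renN_snd, a, b]
      exact ⟨rfl, rfl⟩
  · intro x y hx hy e1 e2
    rw [hraw x hx]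
    rcases hleaf x hx with ⟨a, r, hr, rfl⟩ | ⟨x0, hx0, rfl⟩ <;>
      rcases hleaf y hy with ⟨b, s, hs, rfl⟩ | ⟨y0, hy0, rfl⟩
    · rw [st_newRel _ _ _ hr, st_newRel _ _ _ hs] at e2
      have e3 : a = b := by simpa using e2.eq_of_length (by simp)
      subst e3
      obtain ⟨r', e, hr', hall⟩ := raw_newRel Q.pair c q hr
      rw [e]
      rcases hall s hs with rfl | rfl
      · exact Or.inl rfl
      · exact Or.inr rfl
    · exfalso
      rw [st_newRel _ _ _ hr, st_lamB_bump] at e1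
      unfold renS at e1
      rw [canon_renN] at e1
      exact map_bump_ne _ _ _ _ _ e1.symm
    · exfalso
      rw [st_newRel _ _ _ hs, st_lamB_bump] at e1
      unfold renS at e1
      rw [canon_renN] at e1
      exact map_bump_ne _ _ _ _ _ e1
    · rw [st_lamB_bump, st_lamB_bump] at e1 e2
      unfold renS at e1 e2
      rw [canon_renN, canon_renN] at e1
      rw [renN_snd, renN_snd] at e2
      have e3 := Sum.map_injective.mpr ⟨Function.injective_id, bump_inj c q i (loneIdx i v)⟩ e1
      rw [raw_bump]
      rcases h2 x0 y0 hx0 hy0 e3 e2 with e | e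
      · exact Or.inl (by rw [e])
      · exact Or.inr (by rw [e])

theorem exists_inv {Q Q0 : Couple} (h : Relation.ReflTransGen Step Q0 Q) :
    ∃ lam, Inv Q0.pair Q lam := by
  induction h with
  | refl => exact ⟨_, inv_init Q0⟩
  | tail _ hs ih =>
    obtain ⟨lam, ih⟩ := ih
    rcases hs with hs | hs
    · exact inv_stepA ih hs
    · exact inv_stepB ih hs

/-! ### Counting -/

/-- The preorder word of a tree with instructions. -/
def word (lam : NodeId → Instr) (c : Bool) : TTree → Pos → List (Bool × Instr)
  | .leaf, p => [(false, lam (c, p))]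
  | .node x y z, p => (true, lam (c, p)) ::
      (word lam c x (p ++ [0]) ++ (word lam c y (p ++ [1]) ++ word lam c z (p ++ [2])))

theorem word_length (lam : NodeId → Instr) (c : Bool) (t : TTree) (p : Pos) :
    (word lam c t p).length = 3 * t.scale + 1 := by
  induction t generalizing p with
  | leaf => rfl
  | node x y z hx hy hz =>
    simp only [word, List.length_cons, List.length_append, hx, hy, hz, TTree.scale]
    ring

theorem word_inj (lam lam' : NodeId → Instr) (c : Bool) (t t' : TTree) (p : Pos)
    (s s' : List (Bool × Instr)) (h : word lam c t p ++ s = word lam' c t' p ++ s') :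
    t = t' ∧ s = s' ∧ ∀ r, (t.subtreeAt? r).isSome → lam (c, p ++ r) = lam' (c, p ++ r) := by
  induction t generalizing t' p s s' with
  | leaf =>
    cases t' with
    | node => simp [word] at h
    | leaf =>
      simp only [word, List.cons_append, List.nil_append, List.cons.injEq, Prod.mk.injEq,
        true_and] at h
      refine ⟨rfl, h.2, ?_⟩
      intro r hr
      cases r with
      | nil => simpa using h.1
      | cons => simp [TTree.subtreeAt?] at hr
  | node x y z hx hy hz =>
    cases t' with
    | leaf => simp [word] at h
    | node x' y' z' =>
      simp only [word, List.cons_append, List.append_assoc, List.cons.injEq, Prod.mk.injEq,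
        true_and] at h
      obtain ⟨h0, h⟩ := h
      obtain ⟨rfl, h, ax⟩ := hx _ _ _ _ h
      obtain ⟨rfl, h, ay⟩ := hy _ _ _ _ h
      obtain ⟨rfl, h, az⟩ := hz _ _ _ _ h
      refine ⟨rfl, h, ?_⟩
      intro r hr
      cases r with
      | nil => simpa using h0
      | cons k r =>
        rw [subtreeAt?_node] at hr
        have e : p ++ k :: r = (p ++ [k]) ++ r := by simp
        rw [e]
        fin_cases k
        · exact ax r hr
        · exact ay r hr
        · exact az r hr

theorem st_congr {lam lam' : NodeId → Instr} {c : Bool} {t : TTree}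
    (h : ∀ r, (t.subtreeAt? r).isSome → lam (c, r) = lam' (c, r)) (p : Pos)
    (hp : (t.subtreeAt? p).isSome) : st lam (c, p) = st lam' (c, p) := by
  induction p using List.reverseRecOn with
  | nil => rfl
  | append_singleton p k ih => rw [st_snoc, st_snoc, ih (isSome_of_snoc hp), h _ hp]

/-- The code word of a couple with instructions. -/
def code (Q : Couple) (lam : NodeId → Instr) : List (Bool × Instr) :=
  word lam true Q.pos [] ++ word lam false Q.neg []

theorem code_length (Q : Couple) (lam : NodeId → Instr) :
    (code Q lam).length = 3 * Q.scale + 2 := by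
  simp only [code, List.length_append, word_length, Couple.scale]
  ring

theorem code_inj {f : NodeId → NodeId} {Q Q' : Couple} {lam lam' : NodeId → Instr}
    (h : Inv f Q lam) (h' : Inv f Q' lam') (e : code Q lam = code Q' lam') : Q = Q' := by
  obtain ⟨e1, e2, a1⟩ := word_inj _ _ _ _ _ _ _ _ e
  obtain ⟨e3, -, a2⟩ := word_inj lam lam' false Q.neg Q'.neg [] [] [] (by simpa using e2)
  refine inv_unique h h' e1 e3 ?_
  rintro ⟨c, p⟩ hx
  unfold Couple.IsLeaf TTree.IsLeafPos Couple.treeOf at hx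
  cases c
  · exact st_congr a2 p (by simp only [cond_false] at hx; rw [hx]; rfl)
  · exact st_congr a1 p (by simp only [cond_true] at hx; rw [hx]; rfl)

theorem scale_eq_zero {t : TTree} (h : t.scale = 0) : t = .leaf := by
  cases t with
  | leaf => rfl
  | node => simp [TTree.scale] at h

theorem scale_zero_unique {Q Q' : Couple} (h : Q.scale = 0) (h' : Q'.scale = 0) : Q = Q' := by
  have key : ∀ Q : Couple, Q.scale = 0 → Q.pos = .leaf ∧ Q.neg = .leaf := by
    intro Q h
    unfold Couple.scale at h
    exact ⟨scale_eq_zero (by omega), scale_eq_zero (by omega)⟩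
  have key1 : ∀ Q : Couple, Q.scale = 0 → ∀ x, Q.IsLeaf x → x.2 = [] := by
    rintro Q h ⟨c, p⟩ hx
    unfold Couple.IsLeaf Couple.treeOf at hx
    rw [(key Q h).1, (key Q h).2] at hx
    simp only [Bool.cond_self] at hx
    exact (isLeafPos_leaf_iff p).mp hx
  have key2 : ∀ Q : Couple, Q.scale = 0 → ∀ x, Q.IsLeaf x → Q.pair x = (!x.1, []) := by
    intro Q h x hx
    have a := key1 Q h x hx
    have b := key1 Q h _ (Couple.isLeaf_pair hx)
    have d := Q.pair_ne x hx
    refine Prod.ext ?_ b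
    by_contra hne
    apply d
    refine Prod.ext ?_ (b.trans a.symm)
    revert hne
    cases (Q.pair x).1 <;> cases x.1 <;> simp
  refine couple_ext ?_ ?_ ?_
  · rw [(key Q h).1, (key Q' h').1]
  · rw [(key Q h).2, (key Q' h').2]
  · intro x hx
    rw [key2 Q h x hx, key2 Q' h' x]
    unfold Couple.IsLeaf Couple.treeOf at *
    rw [(key Q h).1, (key Q h).2] at hx
    rw [(key Q' h').1, (key Q' h').2]
    exact hx

/-- Corollary 3.13 of Deng–Hani: there is an absolute constant `C` such that, for any prime
couple, the number of couples of scale at most `n` having that skeleton is at most `C ^ n`. -/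
theorem count_couples_with_given_skeleton :
    ∃ C : ℕ, ∀ Qsk : Couple, IsPrime Qsk → ∀ n : ℕ,
      {Q : Couple | HasSkeleton Q Qsk ∧ Q.scale ≤ n}.Finite ∧
        {Q : Couple | HasSkeleton Q Qsk ∧ Q.scale ≤ n}.ncard ≤ C ^ n := by
  classical
  let A := Option (Bool × Instr)
  have hA : 1 ≤ Nat.card A := Nat.card_pos
  refine ⟨Nat.card A ^ 5, ?_⟩
  intro Qsk _ n
  have hinv : ∀ Q : Couple, ∃ lam, HasSkeleton Q Qsk → Inv Qsk.pair Q lam := by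
    intro Q
    by_cases h : HasSkeleton Q Qsk
    · obtain ⟨lam, hl⟩ := exists_inv h.2
      exact ⟨lam, fun _ => hl⟩
    · exact ⟨fun _ => Instr.ext, fun h' => absurd h' h⟩
  choose lam hlam using hinv
  let F : Couple → (Fin (3 * n + 2) → A) := fun Q j => (code Q (lam Q))[(j : ℕ)]?
  have hF : Set.InjOn F {Q : Couple | HasSkeleton Q Qsk ∧ Q.scale ≤ n} := by
    rintro Q ⟨h1, h2⟩ Q' ⟨h1', h2'⟩ e
    apply code_inj (hlam Q h1) (hlam Q' h1')
    apply List.ext_getElem?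
    intro j
    by_cases hj : j < 3 * n + 2
    · exact congrFun e ⟨j, hj⟩
    · rw [List.getElem?_eq_none, List.getElem?_eq_none]
      · rw [code_length]; omega
      · rw [code_length]; omega
  have hfin : {Q : Couple | HasSkeleton Q Qsk ∧ Q.scale ≤ n}.Finite :=
    Set.Finite.of_injOn (Set.mapsTo_univ F _) hF Set.finite_univ
  refine ⟨hfin, ?_⟩
  rcases Nat.eq_zero_or_pos n with rfl | hn
  · rw [pow_zero, Set.ncard_le_one hfin]
    rintro Q ⟨-, h⟩ Q' ⟨-, h'⟩
    exact scale_zero_unique (by omega) (by omega)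
  · calc {Q : Couple | HasSkeleton Q Qsk ∧ Q.scale ≤ n}.ncard
        ≤ (Set.univ : Set (Fin (3 * n + 2) → A)).ncard :=
          Set.ncard_le_ncard_of_injOn F (fun _ _ => Set.mem_univ _) hF Set.finite_univ
      _ = Nat.card A ^ (3 * n + 2) := by
          rw [Set.ncard_univ, Nat.card_fun]
          simp
      _ ≤ Nat.card A ^ (5 * n) := Nat.pow_le_pow_right hA (by omega)
      _ = (Nat.card A ^ 5) ^ n := pow_mul _ _ _

end WKE
end

section
/- Let d ≥ 3 and β ∈ (ℝ⁺)^d. There is a constant C, depending only on d and β, such that for every L ≥ 2, every δ ∈ (0,1], every a ∈ Z_L^d and every γ ∈ ℝ, the number of x ∈ Z_L^d with |x − a| ≤ 1 and | |x|_β² − γ | ≤ δ⁻¹ L⁻² is at most C δ⁻¹ L^{d − 4/3}. -/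
namespace WKE

/-- The Euclidean norm of a vector in `ℝ^d`. -/
noncomputable def euclNorm {d : ℕ} (x : Fin d → ℝ) : ℝ := Real.sqrt (∑ j, x j ^ 2)

/-- `x ∈ Z_L^d = (L⁻¹ℤ)^d`. -/
def isLatticeVec (d : ℕ) (L : ℝ) (x : Fin d → ℝ) : Prop := ∀ j, ∃ m : ℤ, x j = m / L

/-- The weighted square norm `|x|_β² = ∑ j, β j * (x j)²`. -/
noncomputable def wnormSq {d : ℕ} (β x : Fin d → ℝ) : ℝ := ∑ j, β j * x j ^ 2

/-- The weighted inner product `⟨x, y⟩_β = ∑ j, β j * x j * y j`. -/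
noncomputable def winner {d : ℕ} (β x y : Fin d → ℝ) : ℝ := ∑ j, β j * x j * y j

set_option maxHeartbeats 1000000 in
lemma three_pts (p q l : ℝ) (hp : 0 < p) (hq : 0 < q) (hl : 1 ≤ l) (γ : ℝ)
    (m1 m2 m3 n1 n2 n3 : ℤ) (hm1 : |(n1:ℝ)| ≤ m1) (hm2 : |(n2:ℝ)| ≤ m2) (hm3 : |(n3:ℝ)| ≤ m3)
    (h12 : n1 < n2) (h23 : n2 < n3) (hln : (n3:ℝ) - n1 ≤ l)
    (hsep : 2 < q * ((n2:ℝ) - n1) * ((n3:ℝ) - n2))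
    (ha1 : γ ≤ p * (m1:ℝ)^2 + q * (n1:ℝ)^2) (hb1 : p * (m1:ℝ)^2 + q * (n1:ℝ)^2 ≤ γ + 1)
    (ha2 : γ ≤ p * (m2:ℝ)^2 + q * (n2:ℝ)^2) (hb2 : p * (m2:ℝ)^2 + q * (n2:ℝ)^2 ≤ γ + 1)
    (ha3 : γ ≤ p * (m3:ℝ)^2 + q * (n3:ℝ)^2) (hb3 : p * (m3:ℝ)^2 + q * (n3:ℝ)^2 ≤ γ + 1) :
    p * m1 ≤ (1 + (p * ((1 + q) / p)^2 + q)) * l^3 := by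
  have key : ∀ m n : ℤ, |(n:ℝ)| ≤ m → n1 < n → (n:ℝ) - n1 ≤ l →
      γ ≤ p * (m:ℝ)^2 + q * (n:ℝ)^2 → p * (m:ℝ)^2 + q * (n:ℝ)^2 ≤ γ + 1 →
      p * ((m:ℝ) - m1)^2 + q * ((n:ℝ) - n1)^2 ≤ (p * ((1 + q) / p)^2 + q) * l^2 := by
    intro m n hm hn hln ha hb
    have hn' : (n1:ℝ) < n := by exact_mod_cast hn
    have hpos : (1:ℝ) ≤ m1 + m := by
      have h0 : (0:ℝ) < m1 + m := by
        have := abs_nonneg (n1:ℝ)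
        have := abs_nonneg (n:ℝ)
        by_contra hcon
        have e1 : |(n1:ℝ)| = 0 := by linarith
        have e2 : |(n:ℝ)| = 0 := by linarith
        rw [abs_eq_zero] at e1 e2
        linarith
      have : (0:ℤ) < m1 + m := by exact_mod_cast h0
      have : (1:ℤ) ≤ m1 + m := by omega
      exact_mod_cast this
    have hsum : |(n1:ℝ) + n| ≤ m1 + m := (abs_add_le _ _).trans (by linarith)
    have hb : p * |(m:ℝ) - m1| * (m1 + m) ≤ (1 + q * l) * (m1 + m) := by
      have e : p * ((m:ℝ) - m1) * (m1 + m) = (p * (m:ℝ)^2 + q * (n:ℝ)^2 - (p * (m1:ℝ)^2 + q * (n1:ℝ)^2)) - q * ((n:ℝ) - n1) * (n1 + n) := by ring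
      have e2 : p * |(m:ℝ) - m1| * (m1 + m) = |p * ((m:ℝ) - m1) * (m1 + m)| := by
        rw [abs_mul, abs_mul, abs_of_pos hp, abs_of_pos (by linarith : (0:ℝ) < m1 + m)]
      rw [e2, e]
      have e3 : |q * ((n:ℝ) - n1) * (n1 + n)| ≤ q * l * (m1 + m) := by
        rw [abs_mul, abs_mul, abs_of_pos hq, abs_of_pos (by linarith : (0:ℝ) < (n:ℝ) - n1)]
        gcongr
      have e4 : |(p * (m:ℝ)^2 + q * (n:ℝ)^2 - (p * (m1:ℝ)^2 + q * (n1:ℝ)^2))| ≤ 1 := by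
        rw [abs_le]; constructor <;> linarith
      refine (abs_sub _ _).trans ?_
      nlinarith
    have hc : p * |(m:ℝ) - m1| ≤ 1 + q * l := le_of_mul_le_mul_right hb (by linarith)
    have hd : |(m:ℝ) - m1| ≤ (1 + q) / p * l := by
      rw [div_mul_eq_mul_div, le_div_iff₀ hp]
      nlinarith
    have he : ((m:ℝ) - m1)^2 ≤ ((1 + q) / p * l)^2 := by
      rw [← sq_abs]; gcongr
    have hf : ((n:ℝ) - n1)^2 ≤ l^2 := by
      apply pow_le_pow_left₀ (by linarith) hln
    calc _ ≤ p * ((1 + q) / p * l)^2 + q * l^2 := by gcongr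
      _ = _ := by ring
  have h12' : (n1:ℝ) < n2 := by exact_mod_cast h12
  have h23' : (n2:ℝ) < n3 := by exact_mod_cast h23
  have k2 := key m2 n2 hm2 h12 (by linarith) ha2 hb2
  have k3 := key m3 n3 hm3 (by omega) hln ha3 hb3
  have hC2 : 0 < p * ((1 + q) / p)^2 + q := by positivity
  generalize p * ((1 + q) / p)^2 + q = C2 at *
  clear key
  obtain ⟨E1, hE1⟩ : ∃ E1 : ℝ, E1 = (p * (m2:ℝ)^2 + q * (n2:ℝ)^2) - (p * (m1:ℝ)^2 + q * (n1:ℝ)^2) := ⟨_, rfl⟩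
  obtain ⟨E2, hE2⟩ : ∃ E2 : ℝ, E2 = (p * (m3:ℝ)^2 + q * (n3:ℝ)^2) - (p * (m1:ℝ)^2 + q * (n1:ℝ)^2) := ⟨_, rfl⟩
  have aE1 : |E1| ≤ 1 := by rw [abs_le]; constructor <;> linarith
  have aE2 : |E2| ≤ 1 := by rw [abs_le]; constructor <;> linarith
  have cramer : 2 * (p * m1) * (((m2:ℝ) - m1) * (n3 - n1) - (m3 - m1) * (n2 - n1)) =
      (E1 - (p * ((m2:ℝ) - m1)^2 + q * ((n2:ℝ) - n1)^2)) * (n3 - n1)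
      - (E2 - (p * ((m3:ℝ) - m1)^2 + q * ((n3:ℝ) - n1)^2)) * (n2 - n1) := by
    rw [hE1, hE2]; ring
  have hm1p : (0:ℝ) ≤ m1 := (abs_nonneg _).trans hm1
  by_cases hD : ((m2 - m1) * (n3 - n1) - (m3 - m1) * (n2 - n1) : ℤ) = 0
  · exfalso
    have hD' : (((m2:ℝ) - m1) * (n3 - n1) - (m3 - m1) * (n2 - n1)) = 0 := by exact_mod_cast hD
    rw [hD'] at cramer
    have hv : 0 < (n2:ℝ) - n1 := by linarith
    have hvw : 0 < (n3:ℝ) - n2 := by linarith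
    have hw : (n3:ℝ) - n1 = (n3 - n2) + (n2 - n1) := by ring
    obtain ⟨v, rfl'⟩ : ∃ v : ℝ, v = (n2:ℝ) - n1 := ⟨_, rfl⟩
    obtain ⟨w, hwd⟩ : ∃ w : ℝ, w = (n3:ℝ) - n1 := ⟨_, rfl⟩
    obtain ⟨v1, hv1⟩ : ∃ v1 : ℝ, v1 = (m2:ℝ) - m1 := ⟨_, rfl⟩
    obtain ⟨w1, hw1⟩ : ∃ w1 : ℝ, w1 = (m3:ℝ) - m1 := ⟨_, rfl⟩
    have hvw2 : (n3:ℝ) - n2 = w - v := by rw [hwd, rfl']; ring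
    rw [hvw2] at hsep hvw
    rw [← rfl', ← hwd, ← hv1, ← hw1] at cramer
    rw [← rfl', ← hwd, ← hv1, ← hw1] at hD'
    rw [← rfl'] at hsep hv
    have hlin : w1 * v = v1 * w := by linarith
    have h1 : v * (E1 * w - E2 * v) = - (w * (w - v) * (p * v1^2 + q * v^2)) := by
      have : v * (E1 * w - E2 * v) = v * ((p * v1^2 + q * v^2) * w - q * w^2 * v) - p * (w1 * v)^2 := by
        linear_combination (-v) * cramer
      rw [this, hlin]; ring
    have h2 : w * (w - v) * (q * v^2) ≤ w * (w - v) * (p * v1^2 + q * v^2) := by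
      have : 0 < w := by linarith
      gcongr
      have := mul_nonneg hp.le (sq_nonneg v1)
      linarith
    have h3 : -(v * (2 * w)) ≤ v * (E1 * w - E2 * v) := by
      rw [abs_le] at aE1 aE2
      have i1 := mul_le_mul_of_nonneg_right aE1.1 (by linarith : (0:ℝ) ≤ w)
      have i2 := mul_le_mul_of_nonneg_right aE2.2 hv.le
      have : -(2 * w) ≤ E1 * w - E2 * v := by linarith
      have := mul_le_mul_of_nonneg_left this hv.le
      linarith
    have h4 : (v * w) * (q * v * (w - v)) ≤ (v * w) * 2 := by linarith
    have h5 := le_of_mul_le_mul_left h4 (by apply mul_pos <;> linarith)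
    linarith
  · have hD1 : (1:ℝ) ≤ |(((m2:ℝ) - m1) * (n3 - n1) - (m3 - m1) * (n2 - n1))| := by
      have := Int.one_le_abs hD
      exact_mod_cast this
    have hq1 : 0 ≤ p * ((m2:ℝ) - m1)^2 + q * ((n2:ℝ) - n1)^2 := by positivity
    have hq2 : 0 ≤ p * ((m3:ℝ) - m1)^2 + q * ((n3:ℝ) - n1)^2 := by positivity
    generalize p * ((m2:ℝ) - m1)^2 + q * ((n2:ℝ) - n1)^2 = Q1 at *
    generalize p * ((m3:ℝ) - m1)^2 + q * ((n3:ℝ) - n1)^2 = Q2 at *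
    have hl2 : 1 ≤ l^2 := one_le_pow₀ hl
    have b1 : |E1 - Q1| ≤ (1 + C2) * l^2 := (abs_sub _ _).trans (by rw [abs_of_nonneg hq1]; nlinarith)
    have b2 : |E2 - Q2| ≤ (1 + C2) * l^2 := (abs_sub _ _).trans (by rw [abs_of_nonneg hq2]; nlinarith)
    have b3 : 2 * (p * m1) * 1 ≤ 2 * ((1 + C2) * l^3) := by
      calc 2 * (p * m1) * 1 ≤ 2 * (p * m1) * |(((m2:ℝ) - m1) * (n3 - n1) - (m3 - m1) * (n2 - n1))| := by gcongr
        _ = |2 * (p * m1) * (((m2:ℝ) - m1) * (n3 - n1) - (m3 - m1) * (n2 - n1))| := by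
          rw [abs_mul (2 * (p * (m1:ℝ))), abs_of_nonneg (by positivity : 0 ≤ 2 * (p * (m1:ℝ)))]
        _ ≤ |(E1 - Q1) * (n3 - n1)| + |(E2 - Q2) * (n2 - n1)| := by
          rw [cramer]; exact abs_sub _ _
        _ ≤ (1 + C2) * l^2 * l + (1 + C2) * l^2 * l := by
          rw [abs_mul, abs_mul, abs_of_pos (by linarith : (0:ℝ) < (n3:ℝ) - n1), abs_of_pos (by linarith : (0:ℝ) < (n2:ℝ) - n1)]
          gcongr <;> linarith
        _ = _ := by ring
    linarith

set_option maxHeartbeats 1000000 in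
/-- count of the points with `|n| ≤ |m|` -/
lemma half_count (p q : ℝ) (hp : 0 < p) (hq : 0 < q) (c0 : ℝ) (hc0 : 0 ≤ c0) :
    ∃ C : ℝ, 0 ≤ C ∧ ∀ T : ℝ, 1 ≤ T → ∀ b γ : ℝ, ((T^3)^2 ≤ γ ∨ T = 1) →
      ∀ S : Finset (ℤ × ℤ), (∀ z ∈ S, |(z.2:ℝ)| ≤ |(z.1:ℝ)| ∧ b ≤ z.2 ∧ (z.2:ℝ) ≤ b + c0 * T^3 ∧
        γ ≤ p * (z.1:ℝ)^2 + q * (z.2:ℝ)^2 ∧ p * (z.1:ℝ)^2 + q * (z.2:ℝ)^2 ≤ γ + 1) →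
      (S.card : ℝ) ≤ C * T^2 := by
  obtain ⟨C2, hC2d⟩ : ∃ C2 : ℝ, C2 = 1 + (p * ((1 + q) / p)^2 + q) := ⟨_, rfl⟩
  have hC2 : 0 < C2 := by rw [hC2d]; positivity
  obtain ⟨κ, hκ0, hκ1, hκ⟩ : ∃ κ : ℝ, 0 < κ ∧ κ ≤ 1 ∧ (1 + p + q) * C2 * κ < p := by
    refine ⟨min 1 (p / (2 * ((1 + p + q) * C2))), by positivity, min_le_left _ _, ?_⟩
    have hX : 0 < (1 + p + q) * C2 := by positivity
    calc _ ≤ ((1 + p + q) * C2) * (p / (2 * ((1 + p + q) * C2))) := by gcongr; exact min_le_right _ _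
      _ = p / 2 := by field_simp
      _ < p := by linarith
  obtain ⟨K, hK⟩ := exists_nat_gt (2 + 2 / q + 2 / p)
  have hK2 : (2:ℝ) < K := by
    have : 0 < 2 / q + 2 / p := by positivity
    linarith
  have hKq : 2 < q * K * K := by
    have : 2 / q < K := by
      have : 0 < 2 / p := by positivity
      linarith
    rw [div_lt_iff₀ hq] at this
    nlinarith
  have hKp : 1 < p * K * K := by
    have : 2 / p < K := by
      have : 0 < 2 / q := by positivity
      linarith
    rw [div_lt_iff₀ hp] at this
    nlinarith
  have hKpos : (0:ℤ) < K := by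
    have : (0:ℝ) < K := by linarith
    exact_mod_cast this
  refine ⟨2 * ((c0 / κ + 2) * (K * K * 2)), by positivity, ?_⟩
  intro T hT b γ hγ S hS
  have hT0 : 0 < T := by linarith
  have hl0 : 0 < κ * T := by positivity
  set l := κ * T with hl
  let f : ℤ × ℤ → ℤ × ℤ × ℤ × Bool := fun z => (⌊(z.2:ℝ) / l⌋, z.2 % K, |z.1| % K, decide (0 ≤ z.1))
  let t : Finset (ℤ × ℤ × ℤ × Bool) :=
    Finset.Icc ⌊b / l⌋ ⌊(b + c0 * T^3) / l⌋ ×ˢ Finset.Ico (0:ℤ) K ×ˢ Finset.Ico (0:ℤ) K ×ˢ Finset.univ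
  have hmaps : ∀ z ∈ S, f z ∈ t := by
    intro z hz
    obtain ⟨-, h1, h2, -, -⟩ := hS z hz
    simp only [f, t, Finset.mem_product, Finset.mem_Icc, Finset.mem_Ico, Finset.mem_univ, and_true]
    refine ⟨⟨Int.floor_le_floor (by gcongr), Int.floor_le_floor (by gcongr)⟩, ⟨?_, ?_⟩, ?_, ?_⟩
    · exact Int.emod_nonneg _ hKpos.ne'
    · exact Int.emod_lt_of_pos _ hKpos
    · exact Int.emod_nonneg _ hKpos.ne'
    · exact Int.emod_lt_of_pos _ hKpos
  -- congruent and ordered implies separated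
  have sep : ∀ x y : ℤ, x < y → x % K = y % K → (K:ℝ) ≤ (y:ℝ) - x := by
    intro x y hxy h
    have : (K:ℤ) ∣ y - x := Int.ModEq.dvd h
    have := Int.le_of_dvd (by omega) this
    exact_mod_cast this
  have sameN : ∀ x ∈ S, ∀ y ∈ S, f x = f y → x.2 = y.2 → x = y := by
    have aux : ∀ x ∈ S, ∀ y ∈ S, f x = f y → x.2 = y.2 → ¬ |x.1| < |y.1| := by
      intro x hx y hy hf h2 hlt
      obtain ⟨-, -, -, hx1, hx2⟩ := hS x hx
      obtain ⟨-, -, -, hy1, hy2⟩ := hS y hy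
      simp only [f, Prod.mk.injEq] at hf
      have hs := sep _ _ hlt hf.2.2.1
      rw [← sq_abs (x.1:ℝ)] at hx1 hx2
      rw [← sq_abs (y.1:ℝ)] at hy1 hy2
      push_cast at hs
      rw [h2] at hx1 hx2
      have h0 := abs_nonneg (x.1:ℝ)
      have : (K:ℝ) * K ≤ |(y.1:ℝ)|^2 - |(x.1:ℝ)|^2 := by nlinarith
      nlinarith
    intro x hx y hy hf h2
    have a1 := aux x hx y hy hf h2
    have a2 := aux y hy x hx hf.symm h2.symm
    have a3 : |x.1| = |y.1| := by omega
    simp only [f, Prod.mk.injEq, decide_eq_decide] at hf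
    have hs := hf.2.2.2
    refine Prod.ext ?_ h2
    rcases abs_eq_abs.1 a3 with h | h
    · exact h
    · omega
  have ordered : ∀ x ∈ S, ∀ y ∈ S, ∀ z ∈ S, f x = f y → f x = f z → x.2 < y.2 → y.2 < z.2 → False := by
    intro x hx y hy z hz hxy hxz h12 h23
    obtain ⟨x0, -, -, hx1, hx2⟩ := hS x hx
    obtain ⟨y0, -, -, hy1, hy2⟩ := hS y hy
    obtain ⟨z0, -, -, hz1, hz2⟩ := hS z hz
    simp only [f, Prod.mk.injEq] at hxy hxz
    have s1 := sep _ _ h12 hxy.2.1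
    have s2 := sep _ _ h23 (hxy.2.1.symm.trans hxz.2.1)
    have hwin : (z.2:ℝ) - x.2 ≤ l := by
      have h := Int.abs_sub_lt_one_of_floor_eq_floor hxz.1
      rw [abs_lt] at h
      have h' : ((z.2:ℝ) - x.2) / l < 1 := by rw [sub_div]; linarith
      rw [div_lt_one hl0] at h'
      exact h'.le
    have hl1 : 1 ≤ l := by linarith
    have hsep : 2 < q * ((y.2:ℝ) - x.2) * ((z.2:ℝ) - y.2) := by
      refine hKq.trans_le ?_
      have : (0:ℝ) ≤ (y.2:ℝ) - x.2 := by linarith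
      gcongr
    rcases hγ with hγ | hγ
    · have := three_pts p q l hp hq hl1 γ |x.1| |y.1| |z.1| x.2 y.2 z.2 (by push_cast; exact x0)
        (by push_cast; exact y0) (by push_cast; exact z0) h12 h23 hwin hsep
        (by push_cast; rwa [sq_abs]) (by push_cast; rwa [sq_abs]) (by push_cast; rwa [sq_abs]) (by push_cast; rwa [sq_abs])
        (by push_cast; rwa [sq_abs]) (by push_cast; rwa [sq_abs])
      rw [← hC2d] at this
      push_cast at this
      have hsq : (x.2:ℝ)^2 ≤ (x.1:ℝ)^2 := sq_le_sq.2 x0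
      have hx3 : (T^3)^2 ≤ ((1 + p + q) * |(x.1:ℝ)|)^2 := by
        rw [mul_pow, sq_abs]
        have : (T^3)^2 ≤ (p + q) * (x.1:ℝ)^2 := by
          have := mul_le_mul_of_nonneg_left hsq hq.le
          linarith
        refine this.trans ?_
        have : p + q ≤ (1 + p + q)^2 := by nlinarith only [hp, hq]
        gcongr
      have hx4 : T^3 ≤ (1 + p + q) * |(x.1:ℝ)| := (sq_le_sq₀ (by positivity) (by positivity)).1 hx3
      have hx5 : p * T^3 ≤ ((1 + p + q) * C2 * κ) * T^3 := by
        calc p * T^3 ≤ p * ((1 + p + q) * |(x.1:ℝ)|) := by gcongr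
          _ = (1 + p + q) * (p * |(x.1:ℝ)|) := by ring
          _ ≤ (1 + p + q) * (C2 * l^3) := by gcongr
          _ = (1 + p + q) * C2 * κ^3 * T^3 := by rw [hl]; ring
          _ ≤ _ := by
            have : κ^3 ≤ κ := pow_le_of_le_one hκ0.le hκ1 (by norm_num)
            gcongr
      have := le_of_mul_le_mul_right hx5 (by positivity)
      linarith
    · rw [hl, hγ] at hwin
      linarith
  have hfib : ∀ w ∈ t, (S.filter (fun z => f z = w)).card ≤ 2 := by
    intro w _
    by_contra hcon
    push Not at hcon
    obtain ⟨x, hx, y, hy, z, hz, hxy, hxz, hyz⟩ := Finset.two_lt_card.1 hcon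
    rw [Finset.mem_filter] at hx hy hz
    obtain ⟨hx, fx⟩ := hx
    obtain ⟨hy, fy⟩ := hy
    obtain ⟨hz, fz⟩ := hz
    have nxy : x.2 ≠ y.2 := fun h => hxy (sameN x hx y hy (fx.trans fy.symm) h)
    have nxz : x.2 ≠ z.2 := fun h => hxz (sameN x hx z hz (fx.trans fz.symm) h)
    have nyz : y.2 ≠ z.2 := fun h => hyz (sameN y hy z hz (fy.trans fz.symm) h)
    have o1 := ordered x hx y hy z hz (fx.trans fy.symm) (fx.trans fz.symm)
    have o2 := ordered x hx z hz y hy (fx.trans fz.symm) (fx.trans fy.symm)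
    have o3 := ordered y hy x hx z hz (fy.trans fx.symm) (fy.trans fz.symm)
    have o4 := ordered y hy z hz x hx (fy.trans fz.symm) (fy.trans fx.symm)
    have o5 := ordered z hz x hx y hy (fz.trans fx.symm) (fz.trans fy.symm)
    have o6 := ordered z hz y hy x hx (fz.trans fy.symm) (fz.trans fx.symm)
    grind
  have hcard := Finset.card_le_mul_card_image_of_maps_to hmaps 2 hfib
  have htc : (t.card : ℝ) ≤ (c0 / κ + 2) * T^2 * (K * K * 2) := by
    simp only [t, Finset.card_product, Int.card_Icc, Int.card_Ico, Finset.card_univ, Fintype.card_bool, sub_zero, Int.toNat_natCast]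
    push_cast
    have : (((⌊(b + c0 * T^3) / l⌋ + 1 - ⌊b / l⌋).toNat : ℤ) : ℝ) ≤ (c0 / κ + 2) * T^2 := by
      have hle : ⌊b / l⌋ ≤ ⌊(b + c0 * T^3) / l⌋ := Int.floor_le_floor (by gcongr; nlinarith [pow_pos hT0 3])
      rw [Int.toNat_of_nonneg (by omega)]
      push_cast
      have h1 := Int.floor_le ((b + c0 * T^3) / l)
      have h2 := Int.lt_floor_add_one (b / l)
      have h3 : (b + c0 * T^3) / l = b / l + c0 / κ * T^2 := by rw [hl]; field_simp
      nlinarith [one_le_pow₀ hT (n := 2)]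
    rw [Int.cast_natCast] at this
    calc _ ≤ (c0 / κ + 2) * T^2 * (K * (K * 2)) := by gcongr
      _ = _ := by ring
  calc (S.card : ℝ) ≤ 2 * (t.card : ℝ) := by exact_mod_cast hcard
    _ ≤ 2 * ((c0 / κ + 2) * T^2 * (K * K * 2)) := by gcongr
    _ = _ := by ring

lemma window (q : ℝ) (hq : 0 < q) (L R b γ : ℝ) (hR : 1 ≤ R) (h : R = L ∨ γ + 1 ≤ 2 * R^2) :
    ∃ b' : ℝ, ∀ n : ℤ, |(n:ℝ) - b| ≤ L → q * (n:ℝ)^2 ≤ γ + 1 →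
      b' ≤ n ∧ (n:ℝ) ≤ b' + (2 + 2 * (1 + 2 / q)) * R := by
  have hR0 : 0 < R := by linarith
  have hq2 : 0 < 2 / q := by positivity
  have hqR : 0 < 2 / q * R := by positivity
  rcases h with h | h
  · refine ⟨b - L, fun n hn _ => ?_⟩
    rw [abs_le] at hn
    constructor
    · linarith
    · nlinarith
  · refine ⟨-((1 + 2 / q) * R), fun n _ hn => ?_⟩
    have h1 : (n:ℝ)^2 ≤ (2 / q) * R^2 := by
      rw [div_mul_eq_mul_div, le_div_iff₀ hq]; linarith
    have h2 : (n:ℝ)^2 ≤ ((1 + 2 / q) * R)^2 := by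
      refine h1.trans ?_
      rw [mul_pow]
      have : 2 / q ≤ (1 + 2 / q)^2 := by nlinarith
      gcongr
    have h3 := abs_le_of_sq_le_sq' h2 (by positivity)
    constructor
    · exact h3.1
    · nlinarith

lemma two_dim (p q : ℝ) (hp : 0 < p) (hq : 0 < q) :
    ∃ C : ℝ, 0 ≤ C ∧ ∀ L : ℝ, 1 ≤ L → ∀ a b γ : ℝ,
      ∀ S : Finset (ℤ × ℤ), (∀ z ∈ S, |(z.1:ℝ) - a| ≤ L ∧ |(z.2:ℝ) - b| ≤ L ∧
        γ ≤ p * (z.1:ℝ)^2 + q * (z.2:ℝ)^2 ∧ p * (z.1:ℝ)^2 + q * (z.2:ℝ)^2 ≤ γ + 1) →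
      (S.card : ℝ) ≤ C * L ^ (2/3 : ℝ) := by
  obtain ⟨C1, hC1, H1⟩ := half_count p q hp hq (2 + 2 * (1 + 2 / q)) (by positivity)
  obtain ⟨C2, hC2, H2⟩ := half_count q p hq hp (2 + 2 * (1 + 2 / p)) (by positivity)
  refine ⟨C1 + C2, by positivity, ?_⟩
  intro L hL a b γ S hS
  obtain ⟨R, hR1, hRL, hRγ, hR⟩ : ∃ R : ℝ, 1 ≤ R ∧ R ≤ L ∧ (R^2 ≤ γ ∨ R = 1) ∧
      (R = L ∨ γ + 1 ≤ 2 * R^2) := by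
    by_cases h1 : L^2 ≤ γ
    · exact ⟨L, hL, le_rfl, Or.inl h1, Or.inl rfl⟩
    · push Not at h1
      by_cases h2 : 1 ≤ γ
      · have h3 : √γ ^ 2 = γ := Real.sq_sqrt (by linarith)
        refine ⟨√γ, ?_, ?_, Or.inl h3.le, Or.inr ?_⟩
        · exact Real.one_le_sqrt.2 h2
        · exact Real.sqrt_le_iff.2 ⟨by linarith, h1.le⟩
        · rw [h3]; linarith
      · exact ⟨1, le_rfl, hL, Or.inr rfl, Or.inr (by linarith)⟩
  obtain ⟨T, hTd⟩ : ∃ T : ℝ, T = R ^ (1/3 : ℝ) := ⟨_, rfl⟩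
  have hR0 : 0 ≤ R := by linarith
  have hT1 : 1 ≤ T := by rw [hTd]; exact Real.one_le_rpow hR1 (by norm_num)
  have hT3 : T^3 = R := by
    rw [hTd, ← Real.rpow_natCast, ← Real.rpow_mul hR0]; norm_num
  have hT2 : T^2 ≤ L ^ (2/3 : ℝ) := by
    rw [hTd, ← Real.rpow_natCast, ← Real.rpow_mul hR0]
    norm_num
    exact Real.rpow_le_rpow hR0 hRL (by norm_num)
  have hγT : (T^3)^2 ≤ γ ∨ T = 1 := by
    rcases hRγ with h | h
    · left; rwa [hT3]
    · right; rw [hTd, h, Real.one_rpow]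
  obtain ⟨b1, hb1⟩ := window q hq L R b γ hR1 hR
  obtain ⟨a1, ha1⟩ := window p hp L R a γ hR1 hR
  have c1 := H1 T hT1 b1 γ hγT (S.filter (fun z => |(z.2:ℝ)| ≤ |(z.1:ℝ)|)) (by
    intro z hz
    rw [Finset.mem_filter] at hz
    obtain ⟨h1, h2, h3, h4⟩ := hS z hz.1
    have := hb1 z.2 h2 (by have := mul_nonneg hp.le (sq_nonneg (z.1:ℝ)); linarith)
    rw [hT3]
    exact ⟨hz.2, this.1, this.2, h3, h4⟩)
  have c2 := H2 T hT1 a1 γ hγT ((S.filter (fun z => ¬ |(z.2:ℝ)| ≤ |(z.1:ℝ)|)).image Prod.swap) (by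
    intro w hw
    rw [Finset.mem_image] at hw
    obtain ⟨z, hz, rfl⟩ := hw
    rw [Finset.mem_filter] at hz
    obtain ⟨h1, h2, h3, h4⟩ := hS z hz.1
    have := ha1 z.1 h1 (by have := mul_nonneg hq.le (sq_nonneg (z.2:ℝ)); linarith)
    rw [hT3]
    simp only [Prod.fst_swap, Prod.snd_swap]
    exact ⟨(not_le.1 hz.2).le, this.1, this.2, by linarith, by linarith⟩)
  rw [Finset.card_image_of_injective _ Prod.swap_injective] at c2
  have hsum := Finset.card_filter_add_card_filter_not (s := S) (fun z => |(z.2:ℝ)| ≤ |(z.1:ℝ)|)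
  have hsum' : (S.card : ℝ) = ((S.filter (fun z => |(z.2:ℝ)| ≤ |(z.1:ℝ)|)).card : ℝ) +
      ((S.filter (fun z => ¬ |(z.2:ℝ)| ≤ |(z.1:ℝ)|)).card : ℝ) := by
    exact_mod_cast hsum.symm
  calc (S.card : ℝ) ≤ (C1 + C2) * T^2 := by rw [hsum']; linarith
    _ ≤ _ := by gcongr

lemma int_count (e : ℕ) (β : Fin (e + 2) → ℝ) (hβ : ∀ j, 0 < β j) :
    ∃ C : ℝ, 0 ≤ C ∧ ∀ L : ℝ, 1 ≤ L → ∀ D : ℝ, 1 ≤ D → ∀ A : Fin (e + 2) → ℤ, ∀ γ : ℝ,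
      ∀ S : Finset (Fin (e + 2) → ℤ), (∀ m ∈ S, (∀ j, |(m j:ℝ) - A j| ≤ L) ∧
        |(∑ j, β j * (m j:ℝ)^2) - γ| ≤ D) →
      (S.card : ℝ) ≤ C * D * (L ^ e * L ^ (2/3 : ℝ)) := by
  obtain ⟨C, hC, H⟩ := two_dim (β 0) (β 1) (hβ 0) (hβ 1)
  refine ⟨C * (3 ^ e * 3), by positivity, ?_⟩
  intro L hL D hD A γ S hS
  let g : (Fin (e + 2) → ℤ) → (Fin e → ℤ) × ℤ :=
    fun m => (fun j => m j.succ.succ, ⌊(∑ j, β j * (m j:ℝ)^2) - (γ - D)⌋)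
  let t : Finset ((Fin e → ℤ) × ℤ) :=
    Fintype.piFinset (fun j : Fin e => Finset.Icc (A j.succ.succ - ⌊L⌋) (A j.succ.succ + ⌊L⌋)) ×ˢ
      Finset.Icc 0 ⌊2 * D⌋
  have hmaps : ∀ m ∈ S, g m ∈ t := by
    intro m hm
    obtain ⟨h1, h2⟩ := hS m hm
    rw [abs_le] at h2
    simp only [g, t, Finset.mem_product, Fintype.mem_piFinset, Finset.mem_Icc]
    refine ⟨fun j => ?_, ?_, ?_⟩
    · have h := h1 j.succ.succ
      have h3 : |m j.succ.succ - A j.succ.succ| ≤ ⌊L⌋ := by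
        rw [Int.le_floor]; push_cast; exact h
      rw [abs_le] at h3
      constructor <;> linarith
    · exact Int.floor_nonneg.2 (by linarith)
    · exact Int.floor_le_floor (by linarith)
  have hfib : ∀ w ∈ t, (S.filter (fun m => g m = w)).card ≤ ⌊C * L ^ (2/3 : ℝ)⌋₊ := by
    intro w _
    apply Nat.le_floor
    have hinj : Set.InjOn (fun m : Fin (e + 2) → ℤ => (m 0, m 1)) (S.filter (fun m => g m = w)) := by
      intro x hx y hy hxy
      simp only [Finset.coe_filter, Set.mem_setOf_eq] at hx hy
      have hg : g x = g y := hx.2.trans hy.2.symm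
      simp only [g, Prod.mk.injEq] at hg hxy
      funext j
      refine Fin.cases hxy.1 (fun j => ?_) j
      refine Fin.cases hxy.2 (fun j => ?_) j
      exact congrFun hg.1 j
    rw [← Finset.card_image_of_injOn hinj]
    refine H L hL (A 0) (A 1)
      (w.2 + (γ - D) - ∑ j : Fin e, β j.succ.succ * (w.1 j:ℝ)^2) _ ?_
    intro z hz
    rw [Finset.mem_image] at hz
    obtain ⟨m, hm, rfl⟩ := hz
    rw [Finset.mem_filter] at hm
    obtain ⟨hm, rfl⟩ := hm
    obtain ⟨h1, -⟩ := hS m hm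
    have hs : ∑ j, β j * (m j:ℝ)^2 = β 0 * (m 0:ℝ)^2 + (β 1 * (m 1:ℝ)^2 +
        ∑ j : Fin e, β j.succ.succ * (m j.succ.succ:ℝ)^2) := by
      rw [Fin.sum_univ_succ, Fin.sum_univ_succ]; rfl
    have f1 := Int.floor_le ((∑ j, β j * (m j:ℝ)^2) - (γ - D))
    have f2 := Int.lt_floor_add_one ((∑ j, β j * (m j:ℝ)^2) - (γ - D))
    refine ⟨h1 0, h1 1, ?_, ?_⟩
    · simp only [g]; linarith
    · simp only [g]; linarith
  have hcard := Finset.card_le_mul_card_image_of_maps_to hmaps _ hfib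
  have htc : (t.card : ℝ) ≤ (3 * L) ^ e * (3 * D) := by
    simp only [t, Finset.card_product, Fintype.card_piFinset, Int.card_Icc]
    push_cast
    have hL0 : 0 ≤ ⌊L⌋ := Int.floor_nonneg.2 (by linarith)
    have hD0 : 0 ≤ ⌊2 * D⌋ := Int.floor_nonneg.2 (by linarith)
    have k1 : ∀ j : Fin e, (((A j.succ.succ + ⌊L⌋ + 1 - (A j.succ.succ - ⌊L⌋)).toNat : ℕ) : ℝ) ≤ 3 * L := by
      intro j
      rw [← Int.cast_natCast, Int.toNat_of_nonneg (by linarith)]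
      push_cast
      have := Int.floor_le L
      linarith
    have k2 : (((⌊2 * D⌋ + 1 - 0).toNat : ℕ) : ℝ) ≤ 3 * D := by
      rw [← Int.cast_natCast, Int.toNat_of_nonneg (by linarith)]
      push_cast
      have := Int.floor_le (2 * D)
      linarith
    refine mul_le_mul ?_ k2 (by positivity) (by positivity)
    refine (Finset.prod_le_prod (fun _ _ => by positivity) (fun j _ => k1 j)).trans ?_
    simp
  calc (S.card : ℝ) ≤ (⌊C * L ^ (2/3 : ℝ)⌋₊ : ℝ) * (t.card : ℝ) := by exact_mod_cast hcard
    _ ≤ (C * L ^ (2/3 : ℝ)) * ((3 * L) ^ e * (3 * D)) := by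
      have : 0 ≤ C * L ^ (2/3 : ℝ) := by positivity
      gcongr
      exact Nat.floor_le this
    _ = _ := by rw [mul_pow]; ring


/-- Lemma A.5 of Deng–Hani (sphere counting): for `d ≥ 3` and `β ∈ (ℝ⁺)^d` there is a
constant `C = C(d, β)` such that for every `L ≥ 2`, `δ ∈ (0,1]`, `a ∈ Z_L^d` and `γ ∈ ℝ`,
the number of `x ∈ Z_L^d` with `|x - a| ≤ 1` and `||x|_β² - γ| ≤ δ⁻¹ L⁻²` is at most
`C δ⁻¹ L^{d - 4/3}`. -/
theorem sphere_counting (d : ℕ) (hd : 3 ≤ d) (β : Fin d → ℝ) (hβ : ∀ j, 0 < β j) :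
    ∃ C : ℝ, ∀ L δ : ℝ, 2 ≤ L → 0 < δ → δ ≤ 1 →
      ∀ a : Fin d → ℝ, isLatticeVec d L a → ∀ γ : ℝ,
        {x : Fin d → ℝ | isLatticeVec d L x ∧ euclNorm (x - a) ≤ 1 ∧
            |wnormSq β x - γ| ≤ δ⁻¹ * (L ^ 2)⁻¹}.Finite ∧
        ({x : Fin d → ℝ | isLatticeVec d L x ∧ euclNorm (x - a) ≤ 1 ∧
            |wnormSq β x - γ| ≤ δ⁻¹ * (L ^ 2)⁻¹}.ncard : ℝ) ≤
          C * δ⁻¹ * L ^ ((d : ℝ) - 4 / 3) := by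
  obtain ⟨e, rfl⟩ : ∃ e, d = e + 2 := ⟨d - 2, by omega⟩
  obtain ⟨C, hC, H⟩ := int_count e β hβ
  refine ⟨C, ?_⟩
  intro L δ hL hδ0 hδ1 a ha γ
  have hL0 : 0 < L := by linarith
  choose A hA using ha
  set X := {x : Fin (e + 2) → ℝ | isLatticeVec (e + 2) L x ∧ euclNorm (x - a) ≤ 1 ∧
            |wnormSq β x - γ| ≤ δ⁻¹ * (L ^ 2)⁻¹} with hX
  classical
  let F : Finset (Fin (e + 2) → ℤ) :=
    (Fintype.piFinset (fun j => Finset.Icc (A j - ⌊L⌋) (A j + ⌊L⌋))).filter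
      (fun m => (∀ j, |(m j:ℝ) - A j| ≤ L) ∧ |(∑ j, β j * (m j:ℝ)^2) - γ * L^2| ≤ δ⁻¹)
  let φ : (Fin (e + 2) → ℤ) → (Fin (e + 2) → ℝ) := fun m j => (m j : ℝ) / L
  have hsub : X ⊆ (F.image φ : Finset _) := by
    intro x hx
    obtain ⟨hx1, hx2, hx3⟩ := hx
    choose m hm using hx1
    have hb : ∀ j, |(m j:ℝ) - A j| ≤ L := by
      intro j
      have h1 : |(x - a) j| ≤ 1 := by
        refine le_trans ?_ hx2
        rw [euclNorm, ← Real.sqrt_sq_eq_abs]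
        exact Real.sqrt_le_sqrt (Finset.single_le_sum (f := fun j => (x - a) j ^ 2)
          (fun i _ => sq_nonneg _) (Finset.mem_univ j))
      rw [Pi.sub_apply, hm, hA, ← sub_div, abs_div, abs_of_pos hL0, div_le_one hL0] at h1
      exact h1
    rw [Finset.coe_image]
    refine ⟨m, ?_, funext fun j => (hm j).symm⟩
    rw [Finset.mem_coe, Finset.mem_filter, Fintype.mem_piFinset]
    refine ⟨fun j => ?_, hb, ?_⟩
    · have h3 : |m j - A j| ≤ ⌊L⌋ := by
        rw [Int.le_floor]; push_cast; exact hb j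
      rw [abs_le] at h3
      rw [Finset.mem_Icc]
      constructor <;> linarith
    · have h4 : (∑ j, β j * (m j:ℝ)^2) - γ * L^2 = (wnormSq β x - γ) * L^2 := by
        rw [sub_mul, wnormSq, Finset.sum_mul]
        congr 1
        refine Finset.sum_congr rfl fun j _ => ?_
        rw [hm]; field_simp
      rw [h4, abs_mul, abs_of_pos (by positivity : 0 < L^2)]
      calc _ ≤ (δ⁻¹ * (L ^ 2)⁻¹) * L^2 := by gcongr
        _ = δ⁻¹ := by field_simp
  refine ⟨(Finset.finite_toSet _).subset hsub, ?_⟩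
  have h1 : X.ncard ≤ F.card := by
    refine (Set.ncard_le_ncard hsub (Finset.finite_toSet _)).trans ?_
    rw [Set.ncard_coe_finset]
    exact Finset.card_image_le
  have h2 := H L (by linarith) δ⁻¹ ((one_le_inv₀ hδ0).2 hδ1) A (γ * L^2) F
    (fun m hm => (Finset.mem_filter.1 hm).2)
  have h3 : L ^ (((e + 2 : ℕ) : ℝ) - 4 / 3) = L ^ e * L ^ (2/3 : ℝ) := by
    rw [← Real.rpow_natCast, ← Real.rpow_add hL0]
    congr 1
    push_cast
    ring
  rw [h3]
  exact le_trans (by exact_mod_cast h1) h2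

end WKE
end

section
/- Let d ≥ 3, β ∈ (ℝ⁺)^d and L ≥ 2. Call a nonzero x ∈ Z_L^d an L-bad vector if there exist b ∈ Z_L^d and Γ ∈ ℝ such that the number of y ∈ Z_L^d with |y − b| ≤ 1 and |⟨x,y⟩_β − Γ| ≤ L⁻² is at least L^{d−1−1/4}. Assume there is a constant C₀ such that for every R ≥ 1 the number of triples (X,Y,Z) ∈ (ℤ^d)³ with |X|,|Y|,|Z| ≤ R, X ≠ 0 and max(|⟨X,Y⟩_β|, |⟨X,Z⟩_β|) ≤ 1 is at most C₀ R^{3d−4+1/6}. Then there is a constant C, depending only on d and C₀, such that for every a ∈ Z_L^d the number of L-bad vectors x with |x − a| ≤ 1 is at most C L^{d−1−1/4}. -/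
namespace WKE

/-- The set of integer triples `(X, Y, Z)` with `|X|, |Y|, |Z| ≤ R`, `X ≠ 0` and
`max(|⟨X,Y⟩_β|, |⟨X,Z⟩_β|) ≤ 1`. -/
def latticeTriples (d : ℕ) (β : Fin d → ℝ) (R : ℝ) :
    Set ((Fin d → ℤ) × (Fin d → ℤ) × (Fin d → ℤ)) :=
  {T | euclNorm (fun j => (T.1 j : ℝ)) ≤ R ∧ euclNorm (fun j => (T.2.1 j : ℝ)) ≤ R ∧
    euclNorm (fun j => (T.2.2 j : ℝ)) ≤ R ∧ T.1 ≠ 0 ∧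
    max |winner β (fun j => (T.1 j : ℝ)) (fun j => (T.2.1 j : ℝ))|
        |winner β (fun j => (T.1 j : ℝ)) (fun j => (T.2.2 j : ℝ))| ≤ 1}

/-- `x` is an `L`-bad vector: a nonzero `x ∈ Z_L^d` for which there exist `b ∈ Z_L^d` and
`Γ ∈ ℝ` such that the number of `y ∈ Z_L^d` with `|y - b| ≤ 1` and `|⟨x,y⟩_β - Γ| ≤ L⁻²`
is at least `L^{d - 1 - 1/4}`. -/
def IsBadVec (d : ℕ) (β : Fin d → ℝ) (L : ℝ) (x : Fin d → ℝ) : Prop :=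
  x ≠ 0 ∧ isLatticeVec d L x ∧
  ∃ (b : Fin d → ℝ) (Γ : ℝ), isLatticeVec d L b ∧
    L ^ ((d : ℝ) - 1 - 1 / 4) ≤
      ({y : Fin d → ℝ | isLatticeVec d L y ∧ euclNorm (y - b) ≤ 1 ∧
          |winner β x y - Γ| ≤ (L ^ 2)⁻¹}.ncard : ℝ)



/-- integer version of badness -/
def IBad (d : ℕ) (β : Fin d → ℝ) (L : ℝ) (X : Fin d → ℤ) : Prop :=
  X ≠ 0 ∧ ∃ (B : Fin d → ℤ) (G : ℝ) (S : Finset (Fin d → ℤ)),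
    L ^ ((d : ℝ) - 1 - 1 / 4) ≤ (S.card : ℝ) ∧
    ∀ Y ∈ S, euclNorm (fun j => (Y j : ℝ) - B j) ≤ L ∧
      |winner β (fun j => (X j : ℝ)) (fun j => (Y j : ℝ)) - G| ≤ 1

lemma abs_le_euclNorm {d : ℕ} (x : Fin d → ℝ) (j : Fin d) : |x j| ≤ euclNorm x := by
  unfold euclNorm
  apply Real.abs_le_sqrt
  exact Finset.single_le_sum (f := fun j => x j ^ 2) (fun i _ => sq_nonneg _) (Finset.mem_univ j)

lemma euclNorm_smul {d : ℕ} (c : ℝ) (hc : 0 ≤ c) (x : Fin d → ℝ) :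
    euclNorm (fun j => c * x j) = c * euclNorm x := by
  unfold euclNorm
  have : ∑ j, (c * x j) ^ 2 = c ^ 2 * ∑ j, x j ^ 2 := by
    rw [Finset.mul_sum]; exact Finset.sum_congr rfl (fun j _ => by ring)
  rw [this, Real.sqrt_mul (sq_nonneg c), Real.sqrt_sq hc]

lemma euclNorm_eq {d : ℕ} (x : Fin d → ℝ) : euclNorm x = ‖WithLp.toLp 2 x‖ := by
  unfold euclNorm
  rw [EuclideanSpace.norm_eq]
  simp

lemma euclNorm_sub_le {d : ℕ} (x y : Fin d → ℝ) :
    euclNorm (fun j => x j - y j) ≤ euclNorm x + euclNorm y := by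
  rw [euclNorm_eq, euclNorm_eq, euclNorm_eq]
  exact norm_sub_le (WithLp.toLp 2 x) (WithLp.toLp 2 y)

lemma IBad_of_bad {d : ℕ} {β : Fin d → ℝ} {L : ℝ} (hL : 2 ≤ L) {X : Fin d → ℤ}
    (h : IsBadVec d β L (fun j => (X j : ℝ) / L)) : IBad d β L X := by
  have hL0 : (0:ℝ) < L := by linarith
  obtain ⟨h0, -, b, Γ, hb, hc⟩ := h
  refine ⟨fun h => h0 ?_, ?_⟩
  · subst h; ext j; simp
  choose B hB using hb
  set T := {y : Fin d → ℝ | isLatticeVec d L y ∧ euclNorm (y - b) ≤ 1 ∧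
          |winner β (fun j => (X j : ℝ) / L) y - Γ| ≤ (L ^ 2)⁻¹} with hT
  have hpos : (0:ℝ) < L ^ ((d : ℝ) - 1 - 1 / 4) := Real.rpow_pos_of_pos hL0 _
  have hne : T.ncard ≠ 0 := by
    intro h; rw [h] at hc; simp at hc; linarith
  have hfin : T.Finite := Set.finite_of_ncard_ne_zero hne
  have key : ∀ y ∈ T, ∃ Y : Fin d → ℤ, ∀ j, y j = Y j / L := by
    rintro y ⟨hy, -⟩
    choose Y hY using hy
    exact ⟨Y, hY⟩
  choose! φ hφ using key
  refine ⟨B, L ^ 2 * Γ, hfin.toFinset.image φ, ?_, ?_⟩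
  · rw [Finset.card_image_of_injOn]
    · rwa [← Set.ncard_eq_toFinset_card T hfin]
    · intro y hy z hz hyz
      simp at hy hz
      ext j; rw [hφ y hy, hφ z hz, hyz]
  · intro Y hY
    simp only [Finset.mem_image, Set.Finite.mem_toFinset] at hY
    obtain ⟨y, hy, rfl⟩ := hY
    have e := hφ y hy
    obtain ⟨-, h1, h2⟩ := hy
    constructor
    · have : (fun j => ((φ y j : ℝ)) - B j) = fun j => L * ((y - b) j) := by
        ext j; simp only [Pi.sub_apply]; rw [e, hB]; field_simp
      rw [this, euclNorm_smul _ hL0.le]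
      nlinarith
    · have : winner β (fun j => (X j : ℝ)) (fun j => ((φ y j : ℤ) : ℝ))
          = L ^ 2 * winner β (fun j => (X j : ℝ) / L) y := by
        unfold winner
        rw [Finset.mul_sum]
        refine Finset.sum_congr rfl fun j _ => ?_
        rw [e]; field_simp
      rw [this, ← mul_sub, abs_mul, abs_of_pos (by positivity)]
      calc L ^ 2 * _ ≤ L ^ 2 * (L ^ 2)⁻¹ := by gcongr
        _ = 1 := by field_simp

/-- finite counting of integer vectors in a box -/
lemma card_Icc_le (a b : ℝ) (h : a ≤ b) : ((Finset.Icc ⌈a⌉ ⌊b⌋).card : ℝ) ≤ b - a + 1 := by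
  rw [Int.card_Icc]
  have h1 := Int.floor_le b
  have h2 := Int.le_ceil a
  rcases le_total 0 (⌊b⌋ + 1 - ⌈a⌉) with h0 | h0
  · have : (((⌊b⌋ + 1 - ⌈a⌉).toNat : ℤ) : ℝ) = ((⌊b⌋ + 1 - ⌈a⌉ : ℤ) : ℝ) := by
      rw [Int.toNat_of_nonneg h0]
    rw [Int.cast_natCast] at this
    rw [this]; push_cast; linarith
  · rw [Int.toNat_of_nonpos h0]; simp; linarith

/-- integer box of real radius `r` about `A` -/
noncomputable def ibox {d : ℕ} (A : Fin d → ℤ) (r : ℝ) : Finset (Fin d → ℤ) :=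
  Fintype.piFinset fun j => Finset.Icc ⌈(A j : ℝ) - r⌉ ⌊(A j : ℝ) + r⌋

lemma mem_ibox {d : ℕ} {A X : Fin d → ℤ} {r : ℝ} :
    X ∈ ibox A r ↔ ∀ j, |(X j : ℝ) - A j| ≤ r := by
  simp only [ibox, Fintype.mem_piFinset, Finset.mem_Icc, Int.ceil_le, Int.le_floor, abs_le]
  refine forall_congr' fun j => ?_
  constructor <;> rintro ⟨h1, h2⟩ <;> constructor <;> linarith

lemma card_ibox_le {d : ℕ} (A : Fin d → ℤ) (r : ℝ) (hr : 0 ≤ r) :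
    ((ibox A r).card : ℝ) ≤ (2 * r + 1) ^ d := by
  rw [ibox, Fintype.card_piFinset]
  push_cast
  calc _ ≤ ∏ j : Fin d, (2 * r + 1) := by
        apply Finset.prod_le_prod
        · intros; positivity
        · intro j _
          refine (card_Icc_le _ _ (by linarith)).trans ?_
          linarith
    _ = _ := by simp

lemma finite_latticeTriples (d : ℕ) (β : Fin d → ℝ) (R : ℝ) :
    (latticeTriples d β R).Finite := by
  have hb : ∀ X : Fin d → ℤ, euclNorm (fun j => (X j : ℝ)) ≤ R → X ∈ ibox (0 : Fin d → ℤ) R := by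
    intro X hX
    rw [mem_ibox]; intro j
    simpa using (abs_le_euclNorm _ j).trans hX
  refine ((ibox (0 : Fin d → ℤ) R) ×ˢ (ibox (0 : Fin d → ℤ) R) ×ˢ
    (ibox (0 : Fin d → ℤ) R)).finite_toSet.subset ?_
  rintro ⟨X, Y, Z⟩ ⟨h1, h2, h3, -⟩
  simp only [Finset.coe_product, Set.mem_prod, Finset.mem_coe]
  exact ⟨hb _ h1, hb _ h2, hb _ h3⟩

/-- reduction to the integer problem -/
lemma reduce {d : ℕ} {β : Fin d → ℝ} {L : ℝ} (hL : 2 ≤ L) {a : Fin d → ℝ}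
    (ha : isLatticeVec d L a) (K : ℝ)
    (H : ∀ (A : Fin d → ℤ) (M : Finset (Fin d → ℤ)),
      (∀ X ∈ M, IBad d β L X ∧ euclNorm (fun j => (X j : ℝ) - A j) ≤ L) → (M.card : ℝ) ≤ K) :
    {x : Fin d → ℝ | IsBadVec d β L x ∧ euclNorm (x - a) ≤ 1}.Finite ∧
        ({x : Fin d → ℝ | IsBadVec d β L x ∧ euclNorm (x - a) ≤ 1}.ncard : ℝ) ≤ K := by
  classical
  have hL0 : (0:ℝ) < L := by linarith
  choose A hA using ha
  set T := {x : Fin d → ℝ | IsBadVec d β L x ∧ euclNorm (x - a) ≤ 1} with hT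
  let P : (Fin d → ℤ) → Prop := fun X =>
    IBad d β L X ∧ euclNorm (fun j => (X j : ℝ) - A j) ≤ L
  let M := (ibox A L).filter P
  let ψ : (Fin d → ℤ) → (Fin d → ℝ) := fun X j => (X j : ℝ) / L
  have hsub : T ⊆ ((M.image ψ : Finset (Fin d → ℝ)) : Set (Fin d → ℝ)) := by
    rintro x ⟨hx, hxa⟩
    have hlat := hx.2.1
    choose X hX using hlat
    have hxe : x = ψ X := funext hX
    rw [Finset.mem_coe, Finset.mem_image]
    refine ⟨X, ?_, hxe.symm⟩
    have hn : euclNorm (fun j => (X j : ℝ) - A j) ≤ L := by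
      have : (fun j => ((X j : ℝ)) - A j) = fun j => L * ((x - a) j) := by
        ext j; simp only [Pi.sub_apply]; rw [hX, hA]; field_simp
      rw [this, euclNorm_smul _ hL0.le]
      nlinarith
    rw [Finset.mem_filter]
    refine ⟨mem_ibox.2 fun j => (abs_le_euclNorm (fun j => (X j : ℝ) - A j) j).trans hn, ?_, hn⟩
    rw [hxe] at hx
    exact IBad_of_bad hL hx
  refine ⟨(Finset.finite_toSet _).subset hsub, ?_⟩
  have h1 : T.ncard ≤ (M.image ψ).card := by
    rw [← Set.ncard_coe_finset]
    exact Set.ncard_le_ncard hsub (Finset.finite_toSet _)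
  have h2 : (M.image ψ).card ≤ M.card := Finset.card_image_le
  have h3 := H A M (fun X hX => (Finset.mem_filter.1 hX).2)
  have : (T.ncard : ℝ) ≤ (M.card : ℝ) := by exact_mod_cast h1.trans h2
  linarith

lemma winner_sub_left {d : ℕ} (β x x' y : Fin d → ℝ) :
    winner β (fun j => x j - x' j) y = winner β x y - winner β x' y := by
  unfold winner; rw [← Finset.sum_sub_distrib]
  exact Finset.sum_congr rfl fun j _ => by ring

lemma winner_sub_right {d : ℕ} (β x y y' : Fin d → ℝ) :
    winner β x (fun j => y j - y' j) = winner β x y - winner β x y' := by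
  unfold winner; rw [← Finset.sum_sub_distrib]
  exact Finset.sum_congr rfl fun j _ => by ring

/-- A bad vector is almost orthogonal to many small vectors. -/
lemma exists_diff {d : ℕ} {β : Fin d → ℝ} {L : ℝ} (hL : 2 ≤ L) {X : Fin d → ℤ}
    (h : IBad d β L X) : ∃ D : Finset (Fin d → ℤ),
      L ^ ((d : ℝ) - 1 - 1 / 4) / 5 ≤ (D.card : ℝ) ∧ ∀ Y ∈ D,
        euclNorm (fun j => (Y j : ℝ)) ≤ 2 * L ∧
        |winner β (fun j => (X j : ℝ)) (fun j => (Y j : ℝ))| ≤ 1 / 2 := by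
  classical
  have hL0 : (0:ℝ) < L := by linarith
  obtain ⟨-, B, G, S, hS, hY⟩ := h
  have hpos : (0:ℝ) < L ^ ((d : ℝ) - 1 - 1 / 4) := Real.rpow_pos_of_pos hL0 _
  let u : (Fin d → ℤ) → ℝ := fun Y => winner β (fun j => (X j : ℝ)) (fun j => (Y j : ℝ)) - G
  let f : (Fin d → ℤ) → ℤ := fun Y => ⌊2 * u Y⌋
  have hf : ∀ Y ∈ S, f Y ∈ Finset.Icc (-2 : ℤ) 2 := by
    intro Y h
    have := abs_le.1 (hY Y h).2
    rw [Finset.mem_Icc]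
    constructor
    · rw [Int.le_floor]; push_cast; simp only [u]; linarith
    · have : f Y < 3 := by
        rw [Int.floor_lt]; push_cast; simp only [u]; linarith
      omega
  obtain ⟨t, -, ht⟩ : ∃ t ∈ Finset.Icc (-2 : ℤ) 2,
      (S.card : ℝ) / 5 ≤ ((S.filter fun Y => f Y = t).card : ℝ) := by
    by_contra! hcon
    have h1 := Finset.card_eq_sum_card_fiberwise (f := f) (s := S) (t := Finset.Icc (-2 : ℤ) 2) hf
    have h2 : (S.card : ℝ) = ∑ b ∈ Finset.Icc (-2 : ℤ) 2, ((S.filter fun Y => f Y = b).card : ℝ) := by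
      exact_mod_cast h1
    have h3 : ∑ b ∈ Finset.Icc (-2 : ℤ) 2, ((S.filter fun Y => f Y = b).card : ℝ)
        < ∑ b ∈ Finset.Icc (-2 : ℤ) 2, (S.card : ℝ) / 5 :=
      Finset.sum_lt_sum_of_nonempty ⟨0, by simp⟩ hcon
    rw [← h2] at h3
    simp at h3
    linarith
  set S' := S.filter fun Y => f Y = t with hS'
  have hc : L ^ ((d : ℝ) - 1 - 1 / 4) / 5 ≤ (S'.card : ℝ) := by linarith
  have hne : S'.Nonempty := by
    rw [← Finset.card_pos]
    have : (0:ℝ) < S'.card := by linarith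
    exact_mod_cast this
  obtain ⟨Y0, hY0⟩ := hne
  refine ⟨S'.image (fun Y => Y - Y0), ?_, ?_⟩
  · rwa [Finset.card_image_of_injective _ sub_left_injective]
  · intro W hW
    obtain ⟨Y, hYm, rfl⟩ := Finset.mem_image.1 hW
    rw [hS', Finset.mem_filter] at hYm hY0
    have a1 := (hY Y hYm.1).1
    have a2 := (hY Y0 hY0.1).1
    constructor
    · have := euclNorm_sub_le (fun j => (Y j : ℝ) - B j) (fun j => (Y0 j : ℝ) - B j)
      have e : (fun j => (((Y - Y0) j : ℤ) : ℝ)) =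
          fun j => ((Y j : ℝ) - B j) - ((Y0 j : ℝ) - B j) := by ext j; simp
      rw [e]; linarith
    · have e : (fun j => (((Y - Y0) j : ℤ) : ℝ)) = fun j => (Y j : ℝ) - (Y0 j : ℝ) := by
        ext j; simp
      rw [e, winner_sub_right]
      have b1 := Int.floor_le (2 * u Y)
      have b2 := Int.lt_floor_add_one (2 * u Y)
      have b3 := Int.floor_le (2 * u Y0)
      have b4 := Int.lt_floor_add_one (2 * u Y0)
      have c1 : ⌊2 * u Y⌋ = t := hYm.2
      have c2 : ⌊2 * u Y0⌋ = t := hY0.2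
      rw [c1] at b1 b2
      rw [c2] at b3 b4
      simp only [u] at b1 b2 b3 b4
      rw [abs_le]; constructor <;> linarith

/-- The double count, valid in every dimension. -/
lemma double_count {d : ℕ} {β : Fin d → ℝ} {L C₀ : ℝ} (hL : 2 ≤ L)
    (hC : ∀ R : ℝ, 1 ≤ R →
        ((latticeTriples d β R).ncard : ℝ) ≤ C₀ * R ^ (3 * (d : ℝ) - 4 + 1 / 6))
    (A : Fin d → ℤ) (M : Finset (Fin d → ℤ))
    (hM : ∀ X ∈ M, IBad d β L X ∧ euclNorm (fun j => (X j : ℝ) - A j) ≤ L) :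
    (M.card : ℝ) * (L ^ ((d : ℝ) - 1 - 1 / 4) / 5) ^ 2 ≤
      C₀ * (2 * L) ^ (3 * (d : ℝ) - 4 + 1 / 6) + ((4 * L + 1) ^ d) ^ 2 := by
  classical
  have hL0 : (0:ℝ) < L := by linarith
  have hpos : (0:ℝ) < L ^ ((d : ℝ) - 1 - 1 / 4) := Real.rpow_pos_of_pos hL0 _
  have hD : ∀ X ∈ M, ∃ D : Finset (Fin d → ℤ),
      L ^ ((d : ℝ) - 1 - 1 / 4) / 5 ≤ (D.card : ℝ) ∧ ∀ Y ∈ D,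
        euclNorm (fun j => (Y j : ℝ)) ≤ 2 * L ∧
        |winner β (fun j => (X j : ℝ)) (fun j => (Y j : ℝ))| ≤ 1 / 2 :=
    fun X hX => exists_diff hL (hM X hX).1
  choose! D hDc hDY using hD
  let V := M.sigma fun X => D X ×ˢ D X
  have hV : (M.card : ℝ) * (L ^ ((d : ℝ) - 1 - 1 / 4) / 5) ^ 2 ≤ (V.card : ℝ) := by
    rw [Finset.card_sigma]
    push_cast
    rw [← nsmul_eq_mul]
    apply Finset.card_nsmul_le_sum
    intro X hX
    rw [Finset.card_product]; push_cast
    have := hDc X hX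
    rw [sq]; gcongr
  have hex : ∀ p : (Fin d → ℤ) × (Fin d → ℤ), ∃ X0 : Fin d → ℤ,
      (∃ X ∈ M, p.1 ∈ D X ∧ p.2 ∈ D X) → (X0 ∈ M ∧ p.1 ∈ D X0 ∧ p.2 ∈ D X0) := by
    intro p
    by_cases h : ∃ X ∈ M, p.1 ∈ D X ∧ p.2 ∈ D X
    · obtain ⟨X, hX⟩ := h
      exact ⟨X, fun _ => hX⟩
    · exact ⟨0, fun h' => absurd h' h⟩
  choose X0 hX0 using hex
  let T := (finite_latticeTriples d β (2 * L)).toFinset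
  let bx := ibox (0 : Fin d → ℤ) (2 * L)
  let U := T ∪ ({(0 : Fin d → ℤ)} : Finset (Fin d → ℤ)) ×ˢ (bx ×ˢ bx)
  have hU : (U.card : ℝ) ≤
      C₀ * (2 * L) ^ (3 * (d : ℝ) - 4 + 1 / 6) + ((4 * L + 1) ^ d) ^ 2 := by
    have h1 : (U.card : ℝ) ≤ (T.card : ℝ) + (bx.card : ℝ) * bx.card := by
      have := Finset.card_union_le T (({(0 : Fin d → ℤ)} : Finset (Fin d → ℤ)) ×ˢ (bx ×ˢ bx))
      rw [Finset.card_product, Finset.card_product, Finset.card_singleton, one_mul] at this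
      exact_mod_cast this
    have h2 : (T.card : ℝ) ≤ C₀ * (2 * L) ^ (3 * (d : ℝ) - 4 + 1 / 6) := by
      have := hC (2 * L) (by linarith)
      rwa [Set.ncard_eq_toFinset_card _ (finite_latticeTriples d β (2 * L))] at this
    have h3 : (bx.card : ℝ) ≤ (4 * L + 1) ^ d := by
      have := card_ibox_le (0 : Fin d → ℤ) (2 * L) (by linarith)
      convert this using 2; ring
    have h4 : (bx.card : ℝ) * bx.card ≤ ((4 * L + 1) ^ d) ^ 2 := by
      rw [sq]; gcongr
    linarith
  have hVU : V.card ≤ U.card := by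
    apply Finset.card_le_card_of_injOn
      (fun q : (Σ _ : Fin d → ℤ, (Fin d → ℤ) × (Fin d → ℤ)) => (q.1 - X0 q.2, q.2))
    · rintro ⟨X, Y, Z⟩ hq
      have hq' := Finset.mem_coe.1 hq
      simp only [V, Finset.mem_sigma, Finset.mem_product] at hq'
      obtain ⟨hX, hYD, hZD⟩ := hq'
      obtain ⟨m0, y0, z0⟩ := hX0 (Y, Z) ⟨X, hX, hYD, hZD⟩
      have nY := hDY X hX Y hYD
      have nZ := hDY X hX Z hZD
      have nY0 := hDY _ m0 Y y0
      have nZ0 := hDY _ m0 Z z0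
      simp only [U, Finset.coe_union, Set.mem_union, Finset.mem_coe]
      by_cases hz : X - X0 (Y, Z) = 0
      · right
        simp only [Finset.mem_product, Finset.mem_singleton]
        refine ⟨hz, ?_, ?_⟩
        · rw [mem_ibox]; intro j; simpa using (abs_le_euclNorm _ j).trans nY.1
        · rw [mem_ibox]; intro j; simpa using (abs_le_euclNorm _ j).trans nZ.1
      · left
        simp only [T, Set.Finite.mem_toFinset]
        have e : (fun j => (((X - X0 (Y, Z)) j : ℤ) : ℝ)) =
          fun j => (X j : ℝ) - (X0 (Y, Z) j : ℝ) := by ext j; simp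
        refine ⟨?_, nY.1, nZ.1, hz, ?_⟩
        · have := euclNorm_sub_le (fun j => (X j : ℝ) - A j) (fun j => (X0 (Y, Z) j : ℝ) - A j)
          have a1 := (hM X hX).2
          have a2 := (hM _ m0).2
          have e' : (fun j => (((X - X0 (Y, Z)) j : ℤ) : ℝ)) =
            fun j => ((X j : ℝ) - A j) - ((X0 (Y, Z) j : ℝ) - A j) := by ext j; simp
          show euclNorm (fun j => (((X - X0 (Y, Z)) j : ℤ) : ℝ)) ≤ _
          rw [e']; linarith
        · show max |winner β (fun j => (((X - X0 (Y, Z)) j : ℤ) : ℝ)) _|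
            |winner β (fun j => (((X - X0 (Y, Z)) j : ℤ) : ℝ)) _| ≤ 1
          rw [e, winner_sub_left, winner_sub_left]
          have b1 := abs_le.1 nY.2
          have b2 := abs_le.1 nZ.2
          have b3 := abs_le.1 nY0.2
          have b4 := abs_le.1 nZ0.2
          apply max_le <;> rw [abs_le] <;> constructor <;> linarith
    · rintro ⟨X, p⟩ - ⟨X', p'⟩ - h
      simp only [Prod.mk.injEq] at h
      obtain ⟨h1, rfl⟩ := h
      simp at h1
      rw [h1]
  have : (V.card : ℝ) ≤ U.card := by exact_mod_cast hVU
  linarith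

/-- the case `d ≥ 4` -/
lemma case_ge_four (d : ℕ) (hd : 4 ≤ d) (C₀ : ℝ) :
    ∃ C : ℝ, ∀ β : Fin d → ℝ,
      (∀ R : ℝ, 1 ≤ R →
        ((latticeTriples d β R).ncard : ℝ) ≤ C₀ * R ^ (3 * (d : ℝ) - 4 + 1 / 6)) →
      ∀ L : ℝ, 2 ≤ L → ∀ (A : Fin d → ℤ) (M : Finset (Fin d → ℤ)),
      (∀ X ∈ M, IBad d β L X ∧ euclNorm (fun j => (X j : ℝ) - A j) ≤ L) →
        (M.card : ℝ) ≤ C * L ^ ((d : ℝ) - 1 - 1 / 4) := by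
  refine ⟨25 * (|C₀| * 2 ^ (3 * (d : ℝ) - 4 + 1 / 6) + (5 ^ d) ^ 2), ?_⟩
  intro β hC L hL A M hM
  have hL0 : (0:ℝ) < L := by linarith
  have hd' : (4:ℝ) ≤ d := by exact_mod_cast hd
  have h := double_count hL hC A M hM
  set P := L ^ ((d : ℝ) - 1 - 1 / 4) with hP
  have hpos : 0 < P := Real.rpow_pos_of_pos hL0 _
  have hP3 : P ^ 3 = L ^ (3 * (d : ℝ) - 15 / 4) := by
    rw [hP, ← Real.rpow_natCast, ← Real.rpow_mul hL0.le]; congr 1; push_cast; ring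
  have h1 : C₀ * (2 * L) ^ (3 * (d : ℝ) - 4 + 1 / 6) ≤
      |C₀| * 2 ^ (3 * (d : ℝ) - 4 + 1 / 6) * P ^ 3 := by
    rw [Real.mul_rpow (by norm_num) hL0.le, ← mul_assoc, hP3]
    have : L ^ (3 * (d : ℝ) - 4 + 1 / 6) ≤ L ^ (3 * (d : ℝ) - 15 / 4) :=
      Real.rpow_le_rpow_of_exponent_le (by linarith) (by linarith)
    have := le_abs_self C₀
    gcongr
  have h2 : ((4 * L + 1) ^ d) ^ 2 ≤ (5 ^ d) ^ 2 * P ^ 3 := by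
    have e : (4 * L + 1) ^ d ≤ 5 ^ d * L ^ d := by
      rw [← mul_pow]; gcongr; linarith
    have e2 : ((4 * L + 1) ^ d) ^ 2 ≤ (5 ^ d * L ^ d) ^ 2 := by gcongr
    have e3 : (L ^ d) ^ 2 ≤ P ^ 3 := by
      rw [hP3, ← pow_mul, ← Real.rpow_natCast]
      apply Real.rpow_le_rpow_of_exponent_le (by linarith)
      push_cast; linarith
    calc _ ≤ _ := e2
      _ = (5 ^ d) ^ 2 * (L ^ d) ^ 2 := by ring
      _ ≤ _ := by gcongr
  have h3 : (M.card : ℝ) * P ^ 2 ≤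
      (25 * (|C₀| * 2 ^ (3 * (d : ℝ) - 4 + 1 / 6) + (5 ^ d) ^ 2) * P) * P ^ 2 := by
    nlinarith
  exact le_of_mul_le_mul_right h3 (by positivity)

/-- separated integers in an interval -/
lemma card_sep (s : Finset ℤ) (a : ℤ) (r g : ℕ) (hg : 0 < g)
    (hs : ∀ x ∈ s, a ≤ x ∧ x ≤ a + r)
    (hsep : ∀ x ∈ s, ∀ y ∈ s, x ≠ y → (g : ℤ) ≤ |x - y|) :
    (s.card : ℝ) ≤ r / g + 1 := by
  have hg' : (0 : ℤ) < g := by exact_mod_cast hg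
  have h1 : s.card ≤ (Finset.range (r / g + 1)).card := by
    apply Finset.card_le_card_of_injOn (fun x => ((x - a) / g).toNat)
    · intro x hx
      have := hs x hx
      simp only [Finset.coe_range, Set.mem_Iio]
      have h2 : (x - a) / g ≤ ((r / g : ℕ) : ℤ) := by
        push_cast
        exact Int.ediv_le_ediv hg' (by linarith)
      generalize (x - a) / (g:ℤ) = z at h2 ⊢
      generalize r / g = w at h2 ⊢
      omega
    · intro x hx y hy hxy
      by_contra hne
      have h3 := hsep x hx y hy hne
      have hx0 : 0 ≤ (x - a) / (g:ℤ) := Int.ediv_nonneg (by linarith [hs x hx]) hg'.le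
      have hy0 : 0 ≤ (y - a) / (g:ℤ) := Int.ediv_nonneg (by linarith [hs y hy]) hg'.le
      simp only at hxy
      have e : (x - a) / (g:ℤ) = (y - a) / g := by omega
      have x1 := Int.emod_add_mul_ediv (x - a) g
      have y1 := Int.emod_add_mul_ediv (y - a) g
      have x2 := Int.emod_nonneg (x - a) hg'.ne'
      have x3 := Int.emod_lt_of_pos (x - a) hg'
      have y2 := Int.emod_nonneg (y - a) hg'.ne'
      have y3 := Int.emod_lt_of_pos (y - a) hg'
      rw [e] at x1
      have : |x - y| < g := by rw [abs_lt]; constructor <;> linarith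
      linarith
  rw [Finset.card_range] at h1
  have h2 : (s.card : ℝ) ≤ ((r / g : ℕ) : ℝ) + 1 := by exact_mod_cast h1
  have := Nat.cast_div_le (α := ℝ) (m := r) (n := g)
  linarith

lemma exists_min_gap (s : Finset ℤ) (h : ∃ x ∈ s, ∃ y ∈ s, x ≠ y) :
    ∃ x ∈ s, ∃ y ∈ s, x ≠ y ∧ ∀ x' ∈ s, ∀ y' ∈ s, x' ≠ y' → |x - y| ≤ |x' - y'| := by
  obtain ⟨x, hx, y, hy, hne⟩ := h
  obtain ⟨p, hp, hmin⟩ := Finset.exists_min_image (s.offDiag) (fun p => |p.1 - p.2|)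
    ⟨(x, y), by simp [hx, hy, hne]⟩
  rw [Finset.mem_offDiag] at hp
  exact ⟨p.1, hp.1, p.2, hp.2.1, hp.2.2, fun x' hx' y' hy' hne' =>
    hmin (x', y') (by simp [hx', hy', hne'])⟩

/-- many integer points in a planar box: there is a short vertical vector and a
transversal vector spanning a small area -/
lemma planar (Q : Finset (ℤ × ℤ)) (a b : ℤ) (r : ℕ) (hr : 1 ≤ r)
    (hQ : ∀ p ∈ Q, (a ≤ p.1 ∧ p.1 ≤ a + r) ∧ (b ≤ p.2 ∧ p.2 ≤ b + r))
    (hc : 4 * (r : ℝ) ≤ (Q.card : ℝ)) :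
    ∃ p₁ ∈ Q, ∃ p₂ ∈ Q, ∃ p₃ ∈ Q, ∃ p₄ ∈ Q, p₁.1 = p₂.1 ∧ p₁.2 ≠ p₂.2 ∧ p₃.1 ≠ p₄.1 ∧
      |p₁.2 - p₂.2| * |p₃.1 - p₄.1| ≤ r := by
  classical
  have hr' : (1:ℝ) ≤ r := by exact_mod_cast hr
  -- the columns
  set cols := Q.image Prod.fst with hcols
  have hcolb : ∀ x ∈ cols, a ≤ x ∧ x ≤ a + r := by
    intro x hx
    obtain ⟨p, hp, rfl⟩ := Finset.mem_image.1 hx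
    exact (hQ p hp).1
  let fib : ℤ → Finset ℤ := fun x => (Q.filter fun p => p.1 = x).image Prod.snd
  have hfib : ∀ x y, y ∈ fib x ↔ (x, y) ∈ Q := by
    intro x y
    simp only [fib, Finset.mem_image, Finset.mem_filter, Prod.exists]
    constructor
    · rintro ⟨u, v, ⟨h1, h2⟩, h3⟩
      subst h2; subst h3; exact h1
    · intro h; exact ⟨x, y, ⟨h, rfl⟩, rfl⟩
  have hfibcard : ∀ x, (Q.filter fun p => p.1 = x).card = (fib x).card := by
    intro x
    refine (Finset.card_image_of_injOn ?_).symm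
    rintro ⟨u, v⟩ h ⟨u', v'⟩ h' e
    simp at h h' e ⊢
    exact ⟨h.2.trans h'.2.symm, e⟩
  have hfibb : ∀ x, ∀ y ∈ fib x, b ≤ y ∧ y ≤ b + r := by
    intro x y hy
    exact (hQ _ ((hfib x y).1 hy)).2
  have hcardQ : ∀ n : ℝ, (∀ x ∈ cols, ((fib x).card : ℝ) ≤ n) → (Q.card : ℝ) ≤ cols.card * n := by
    intro n hn
    have h1 := Finset.card_eq_sum_card_image (f := Prod.fst) (s := Q)
    have h2 : (Q.card : ℝ) = ∑ x ∈ cols, ((Q.filter fun p => p.1 = x).card : ℝ) := by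
      exact_mod_cast h1
    rw [h2, ← nsmul_eq_mul]
    apply Finset.sum_le_card_nsmul
    intro x hx
    rw [hfibcard]; exact hn x hx
  have hcol1 : (cols.card : ℝ) ≤ r + 1 := by
    have := card_sep cols a r 1 one_pos hcolb (by
      intro x _ y _ hne
      have : x - y ≠ 0 := sub_ne_zero.2 hne
      have := abs_pos.2 this
      push_cast; omega)
    simpa using this
  -- minimal vertical gap, over all columns
  let pairs := (Q ×ˢ Q).filter fun q => q.1.1 = q.2.1 ∧ q.1.2 ≠ q.2.2
  have hpairs : pairs.Nonempty := by
    by_contra hcon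
    rw [Finset.not_nonempty_iff_eq_empty] at hcon
    have : (Q.card : ℝ) ≤ cols.card * 1 := by
      apply hcardQ
      intro x hx
      have : (fib x).card ≤ 1 := by
        rw [Finset.card_le_one]
        intro y hy z hz
        by_contra hne
        have : ((x, y), (x, z)) ∈ pairs := by
          simp only [pairs, Finset.mem_filter, Finset.mem_product]
          exact ⟨⟨(hfib _ _).1 hy, (hfib _ _).1 hz⟩, by trivial, hne⟩
        rw [hcon] at this; simp at this
      exact_mod_cast this
    linarith
  obtain ⟨⟨p₁, p₂⟩, hp, hmin⟩ := Finset.exists_min_image pairs (fun q => |q.1.2 - q.2.2|) hpairs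
  simp only [pairs, Finset.mem_filter, Finset.mem_product] at hp
  obtain ⟨⟨hp1, hp2⟩, he, hne⟩ := hp
  have hs0 : 0 < (p₁.2 - p₂.2).natAbs := Int.natAbs_pos.2 (sub_ne_zero.2 hne)
  set s := (p₁.2 - p₂.2).natAbs with hs
  have hs' : (s : ℤ) = |p₁.2 - p₂.2| := Int.natCast_natAbs _
  have hfs : ∀ x ∈ cols, ((fib x).card : ℝ) ≤ r / s + 1 := by
    intro x hx
    apply card_sep (fib x) b r s hs0 (hfibb x)
    intro y hy z hz hyz
    rw [hs']
    exact hmin ((x, y), (x, z)) (by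
      simp only [pairs, Finset.mem_filter, Finset.mem_product]
      exact ⟨⟨(hfib _ _).1 hy, (hfib _ _).1 hz⟩, by trivial, hyz⟩)
  have hs1 : (1:ℝ) ≤ s := by exact_mod_cast hs0
  have hrs : (r:ℝ) / s ≤ r := div_le_self (by positivity) hs1
  have hQ1 := hcardQ _ hfs
  obtain ⟨x, hx, y, hy, hxy, hmin2⟩ := exists_min_gap cols (by
    by_contra! hcon
    have : cols.card ≤ 1 := Finset.card_le_one.2 hcon
    have : (cols.card : ℝ) ≤ 1 := by exact_mod_cast this
    have h0 : 0 ≤ (r:ℝ) / s := by positivity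
    nlinarith)
  have hq0 : 0 < (x - y).natAbs := Int.natAbs_pos.2 (sub_ne_zero.2 hxy)
  set q := (x - y).natAbs with hq
  have hq' : (q : ℤ) = |x - y| := Int.natCast_natAbs _
  have hq1 : (1:ℝ) ≤ q := by exact_mod_cast hq0
  have hrq : (r:ℝ) / q ≤ r := div_le_self (by positivity) hq1
  have hcq : (cols.card : ℝ) ≤ r / q + 1 := by
    apply card_sep cols a r q hq0 hcolb
    intro u hu v hv huv
    rw [hq']; exact hmin2 u hu v hv huv
  obtain ⟨p₃, hp3, rfl⟩ := Finset.mem_image.1 hx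
  obtain ⟨p₄, hp4, rfl⟩ := Finset.mem_image.1 hy
  refine ⟨p₁, hp1, p₂, hp2, p₃, hp3, p₄, hp4, he, hne, hxy, ?_⟩
  rw [← hs', ← hq']
  have h0 : 0 ≤ (r:ℝ) / s := by positivity
  have hfin : 4 * (r:ℝ) ≤ (r / q + 1) * (r / s + 1) :=
    hc.trans (hQ1.trans (by gcongr))
  have h2 : (r:ℝ) ≤ (r / q) * (r / s) := by nlinarith
  have h3 : (r:ℝ) / q * (r / s) = r * (r / (s * q)) := by field_simp
  rw [h3] at h2
  have h4 : (1:ℝ) ≤ r / (s * q) := by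
    by_contra! h
    nlinarith
  rw [le_div_iff₀ (by positivity)] at h4
  have : (s:ℝ) * q ≤ r := by linarith
  exact_mod_cast this

/-- pigeonhole: a small box with many points -/
lemma small_box (Q : Finset (ℤ × ℤ)) (b₁ b₂ : ℤ) (L u : ℝ) (r : ℕ) (hu : 1 ≤ u) (hLu : L = u ^ 4)
    (hr1 : 64 * u ≤ r) (hrL : (r : ℝ) ≤ L)
    (hQ : ∀ p ∈ Q, |(p.1 : ℝ) - b₁| ≤ L ∧ |(p.2 : ℝ) - b₂| ≤ L)
    (hc : u ^ 7 ≤ (Q.card : ℝ)) :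
    ∃ Q' ⊆ Q, ∃ a b : ℤ, (∀ p ∈ Q', (a ≤ p.1 ∧ p.1 ≤ a + r) ∧ (b ≤ p.2 ∧ p.2 ≤ b + r)) ∧
      4 * (r : ℝ) ≤ (Q'.card : ℝ) := by
  classical
  have hr0 : (0:ℝ) < r := by linarith
  have hL0 : 0 < L := by linarith
  let g : ℤ → ℤ := fun m => ⌊(m:ℝ) / r⌋
  let I : ℤ → Finset ℤ := fun b => Finset.Icc ⌊((b:ℝ) - L) / r⌋ ⌊((b:ℝ) + L) / r⌋
  have hI : ∀ b, ((I b).card : ℝ) ≤ 4 * L / r := by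
    intro b
    simp only [I, Int.card_Icc]
    have h1 := Int.floor_le (((b:ℝ) + L) / r)
    have h2 := Int.lt_floor_add_one (((b:ℝ) - L) / r)
    have h3 : ((b:ℝ) + L) / r - ((b:ℝ) - L) / r = 2 * (L / r) := by ring
    have h4 : 1 ≤ L / r := by rwa [le_div_iff₀ hr0, one_mul]
    have h5 : ⌊((b:ℝ) - L) / r⌋ ≤ ⌊((b:ℝ) + L) / r⌋ := by
      apply Int.floor_le_floor
      gcongr; linarith
    have h6 : (((⌊((b:ℝ) + L) / r⌋ + 1 - ⌊((b:ℝ) - L) / r⌋).toNat : ℤ) : ℝ) =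
        ((⌊((b:ℝ) + L) / r⌋ + 1 - ⌊((b:ℝ) - L) / r⌋ : ℤ) : ℝ) := by
      rw [Int.toNat_of_nonneg (by omega)]
    rw [Int.cast_natCast] at h6
    rw [h6]; push_cast
    have : 4 * L / r = 4 * (L / r) := by ring
    linarith
  have hg : ∀ (m b : ℤ), |(m:ℝ) - b| ≤ L → g m ∈ I b := by
    intro m b h
    have := abs_le.1 h
    simp only [g, I, Finset.mem_Icc]
    constructor <;> apply Int.floor_le_floor <;> gcongr <;> linarith
  let f : ℤ × ℤ → ℤ × ℤ := fun p => (g p.1, g p.2)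
  have hf : ∀ p ∈ Q, f p ∈ I b₁ ×ˢ I b₂ := by
    intro p hp
    exact Finset.mem_product.2 ⟨hg _ _ (hQ p hp).1, hg _ _ (hQ p hp).2⟩
  have hu0 : 0 < u := by linarith
  obtain ⟨t, ht⟩ : ∃ t, 4 * (r:ℝ) ≤ ((Q.filter fun p => f p = t).card : ℝ) := by
    by_contra! hcon
    have h1 := Finset.card_eq_sum_card_fiberwise (f := f) (s := Q) (t := I b₁ ×ˢ I b₂) hf
    have h2 : (Q.card : ℝ) = ∑ b ∈ I b₁ ×ˢ I b₂, ((Q.filter fun p => f p = b).card : ℝ) := by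
      exact_mod_cast h1
    have hne : (I b₁ ×ˢ I b₂).Nonempty := by
      have : (0:ℝ) < Q.card := lt_of_lt_of_le (by positivity) hc
      have : 0 < Q.card := by exact_mod_cast this
      obtain ⟨p, hp⟩ := Finset.card_pos.1 this
      exact ⟨_, hf p hp⟩
    have h3 : ∑ b ∈ I b₁ ×ˢ I b₂, ((Q.filter fun p => f p = b).card : ℝ)
        < ∑ b ∈ I b₁ ×ˢ I b₂, 4 * (r:ℝ) :=
      Finset.sum_lt_sum_of_nonempty hne (fun b _ => hcon b)
    rw [← h2, Finset.sum_const, nsmul_eq_mul, Finset.card_product] at h3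
    push_cast at h3
    have h4 : ((I b₁).card : ℝ) * (I b₂).card ≤ (4 * L / r) * (4 * L / r) := by
      gcongr
      · exact hI b₁
      · exact hI b₂
    have h5 : u ^ 7 < (4 * L / r) * (4 * L / r) * (4 * r) := by
      have : ((I b₁).card : ℝ) * (I b₂).card * (4 * r) ≤ (4 * L / r) * (4 * L / r) * (4 * r) := by
        gcongr
      linarith
    have h6 : (4 * L / r) * (4 * L / r) * (4 * r) = 64 * L ^ 2 / r := by field_simp; ring
    rw [h6, lt_div_iff₀ hr0, hLu] at h5
    have h7 : u ^ 7 * (64 * u) ≤ u ^ 7 * r := by gcongr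
    nlinarith
  refine ⟨_, Finset.filter_subset _ _, r * t.1, r * t.2, ?_, ht⟩
  have key : ∀ m z : ℤ, g m = z → (r:ℤ) * z ≤ m ∧ m ≤ r * z + r := by
    intro m z h
    have h1 := Int.floor_le ((m:ℝ) / r)
    have h2 := Int.lt_floor_add_one ((m:ℝ) / r)
    have h' : ⌊(m:ℝ) / r⌋ = z := h
    rw [h'] at h1 h2
    rw [le_div_iff₀ hr0] at h1
    rw [div_lt_iff₀ hr0] at h2
    constructor
    · have : (r:ℝ) * z ≤ m := by linarith
      exact_mod_cast this
    · have : (m:ℝ) ≤ r * z + r := by linarith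
      exact_mod_cast this
  intro p hp
  have h := (Finset.mem_filter.1 hp).2
  have e1 : g p.1 = t.1 := congrArg Prod.fst h
  have e2 : g p.2 = t.2 := congrArg Prod.snd h
  exact ⟨key _ _ e1, key _ _ e2⟩

/-- In dimension three a bad vector is nearly parallel to a small integer normal. -/
lemma normal_of_bad {β : Fin 3 → ℝ} {L u : ℝ} {r : ℕ} (hu : 1 ≤ u) (hLu : L = u ^ 4)
    (hr1 : 64 * u ≤ r) (hrL : (r : ℝ) ≤ L) {X : Fin 3 → ℤ} (hX : IBad 3 β L X)
    (i k j : Fin 3) (hsum : ∀ f : Fin 3 → ℝ, ∑ l, f l = f i + f k + f j)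
    (hall : ∀ l, l = i ∨ l = k ∨ l = j)
    (hj : (r : ℝ) ≤ |β j * X j|) (hij : |β i * X i| ≤ |β j * X j|)
    (hkj : |β k * X k| ≤ |β j * X j|) :
    ∃ ni nk nj : ℤ, nj ≠ 0 ∧ |nj| ≤ r ∧ |ni| ≤ |nj| + 4 ∧ |nk| ≤ |nj| + 4 ∧
      |β i * X i * nj - β j * X j * ni| ≤ 4 * r ∧ |β k * X k * nj - β j * X j * nk| ≤ 4 * r := by
  classical
  obtain ⟨-, B, G, S, hS, hY⟩ := hX
  have hu0 : 0 < u := by linarith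
  have hr0 : (64:ℝ) ≤ r := by linarith
  have hP : L ^ (((3:ℕ) : ℝ) - 1 - 1 / 4) = u ^ 7 := by
    rw [hLu, ← Real.rpow_natCast, ← Real.rpow_natCast, ← Real.rpow_mul hu0.le]
    congr 1; push_cast; norm_num
  rw [hP] at hS
  set xi := β i * (X i : ℝ)
  set xk := β k * (X k : ℝ)
  set xj := β j * (X j : ℝ)
  have hw : ∀ Y ∈ S, |xi * Y i + xk * Y k + xj * Y j - G| ≤ 1 := by
    intro Y h
    have := (hY Y h).2
    unfold winner at this
    rwa [hsum] at this
  have hd2 : ∀ Y ∈ S, ∀ Z ∈ S,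
      |xi * ((Y i : ℝ) - Z i) + xk * ((Y k : ℝ) - Z k) + xj * ((Y j : ℝ) - Z j)| ≤ 2 := by
    intro Y h Z h'
    have a1 := abs_le.1 (hw Y h)
    have a2 := abs_le.1 (hw Z h')
    rw [abs_le]; constructor <;> nlinarith
  let π : (Fin 3 → ℤ) → ℤ × ℤ := fun Y => (Y i, Y k)
  have hinj : Set.InjOn π S := by
    intro Y h Z h' e
    have e1 : Y i = Z i := congrArg Prod.fst e
    have e2 : Y k = Z k := congrArg Prod.snd e
    have e3 : Y j = Z j := by
      by_contra hne
      have h1 := hd2 Y h Z h'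
      rw [e1, e2] at h1
      simp only [sub_self, mul_zero, zero_add, abs_mul] at h1
      have h2 : (1:ℝ) ≤ |(Y j : ℝ) - Z j| := by
        have : 1 ≤ |Y j - Z j| := Int.one_le_abs (sub_ne_zero.2 hne)
        exact_mod_cast this
      nlinarith
    ext l
    rcases hall l with rfl | rfl | rfl <;> assumption
  obtain ⟨Q', hQ', a, b, hbox, hcard⟩ := small_box (S.image π) (B i) (B k) L u r hu hLu hr1 hrL
    (by
      intro p hp
      obtain ⟨Y, hYS, rfl⟩ := Finset.mem_image.1 hp
      have h1 := (hY Y hYS).1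
      exact ⟨(abs_le_euclNorm (fun j => (Y j : ℝ) - B j) i).trans h1,
        (abs_le_euclNorm (fun j => (Y j : ℝ) - B j) k).trans h1⟩)
    (by rwa [Finset.card_image_of_injOn hinj])
  obtain ⟨p₁, h1, p₂, h2, p₃, h3, p₄, h4, e12, n12, n34, harea⟩ :=
    planar Q' a b r (by have : (1:ℝ) ≤ r := by linarith
                        exact_mod_cast this) hbox hcard
  obtain ⟨Y1, hY1, E1⟩ := Finset.mem_image.1 (hQ' h1)
  obtain ⟨Y2, hY2, E2⟩ := Finset.mem_image.1 (hQ' h2)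
  obtain ⟨Y3, hY3, E3⟩ := Finset.mem_image.1 (hQ' h3)
  obtain ⟨Y4, hY4, E4⟩ := Finset.mem_image.1 (hQ' h4)
  have b1 := hbox _ h1
  have b2 := hbox _ h2
  have b3 := hbox _ h3
  have b4 := hbox _ h4
  rw [← E1] at b1 e12 n12 harea
  rw [← E2] at b2 e12 n12 harea
  rw [← E3] at b3 n34 harea
  rw [← E4] at b4 n34 harea
  simp only [π] at b1 b2 b3 b4 e12 n12 n34 harea
  have d12 := hd2 Y1 hY1 Y2 hY2
  have d34 := hd2 Y3 hY3 Y4 hY4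
  -- the vectors v (vertical) and w
  obtain ⟨vk, hvk⟩ : ∃ v : ℤ, v = Y1 k - Y2 k := ⟨_, rfl⟩
  obtain ⟨vj, hvj⟩ : ∃ v : ℤ, v = Y1 j - Y2 j := ⟨_, rfl⟩
  obtain ⟨wi, hwi⟩ : ∃ v : ℤ, v = Y3 i - Y4 i := ⟨_, rfl⟩
  obtain ⟨wk, hwk⟩ : ∃ v : ℤ, v = Y3 k - Y4 k := ⟨_, rfl⟩
  obtain ⟨wj, hwj⟩ : ∃ v : ℤ, v = Y3 j - Y4 j := ⟨_, rfl⟩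
  have hv : |xk * vk + xj * vj| ≤ 2 := by
    rw [hvk, hvj]; push_cast
    rw [e12] at d12; simpa using d12
  have hwv : |xi * wi + xk * wk + xj * wj| ≤ 2 := by
    rw [hwi, hwk, hwj]; push_cast; exact d34
  rw [← hvk, ← hwi] at harea
  have hvk0 : vk ≠ 0 := by rw [hvk]; exact sub_ne_zero.2 n12
  have hwi0 : wi ≠ 0 := by rw [hwi]; exact sub_ne_zero.2 n34
  have bvk : |(vk:ℝ)| ≤ r := by
    have : |vk| ≤ r := by rw [hvk, abs_le]; constructor <;> linarith
    exact_mod_cast this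
  have bwi : |(wi:ℝ)| ≤ r := by
    have : |wi| ≤ r := by rw [hwi, abs_le]; constructor <;> linarith
    exact_mod_cast this
  have bwk : |(wk:ℝ)| ≤ r := by
    have : |wk| ≤ r := by rw [hwk, abs_le]; constructor <;> linarith
    exact_mod_cast this
  clear_value xi xk xj
  -- n = v × w
  have I1 : |xi * ((-(vk * wi) : ℤ) : ℝ) - xj * ((vk * wj - vj * wk : ℤ) : ℝ)| ≤ 4 * r := by
    have e : xi * ((-(vk * wi) : ℤ) : ℝ) - xj * ((vk * wj - vj * wk : ℤ) : ℝ) =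
        wk * (xk * vk + xj * vj) - vk * (xi * wi + xk * wk + xj * wj) := by push_cast; ring
    rw [e]
    refine (abs_sub _ _).trans ?_
    rw [abs_mul, abs_mul]
    have := abs_nonneg (wk:ℝ)
    have := abs_nonneg (vk:ℝ)
    nlinarith [abs_nonneg (xk * vk + xj * vj), abs_nonneg (xi * wi + xk * wk + xj * wj)]
  have I2 : |xk * ((-(vk * wi) : ℤ) : ℝ) - xj * ((vj * wi : ℤ) : ℝ)| ≤ 4 * r := by
    have e : xk * ((-(vk * wi) : ℤ) : ℝ) - xj * ((vj * wi : ℤ) : ℝ) =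
        -(wi * (xk * vk + xj * vj)) := by push_cast; ring
    rw [e, abs_neg, abs_mul]
    nlinarith [abs_nonneg (xk * vk + xj * vj), abs_nonneg (wi:ℝ)]
  have hbd : ∀ (x : ℝ) (n m : ℤ), |x| ≤ |xj| → |x * n - xj * m| ≤ 4 * r → |m| ≤ |n| + 4 := by
    intro x n m hx h
    have hp : 0 < |xj| := by linarith
    have a1 : |xj * m| ≤ |x * n| + 4 * r := by
      have : xj * m = x * n - (x * n - xj * m) := by ring
      rw [this]
      exact (abs_sub _ _).trans (by linarith)
    rw [abs_mul, abs_mul] at a1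
    have a2 : |xj| * |(m:ℝ)| ≤ |xj| * (|(n:ℝ)| + 4) := by
      nlinarith [abs_nonneg (n:ℝ)]
    have a3 := le_of_mul_le_mul_left a2 hp
    exact_mod_cast a3
  refine ⟨vk * wj - vj * wk, vj * wi, -(vk * wi), ?_, ?_, ?_, ?_, I1, I2⟩
  · exact neg_ne_zero.2 (mul_ne_zero hvk0 hwi0)
  · rw [abs_neg, abs_mul]; exact harea
  · exact hbd xi _ _ hij I1
  · exact hbd xk _ _ hkj I2

/-- pairs `(m, x)` of a small normal component and a coordinate near the line -/
noncomputable def Epairs (b bj c r : ℝ) (t n : ℤ) : Finset (Σ _ : ℤ, ℤ) :=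
  (Finset.Icc (-(|n| + 4)) (|n| + 4)).sigma fun m =>
    Finset.Icc ⌈bj * t * m / (b * n) - 4 * r / (c * |(n:ℝ)|)⌉
      ⌊bj * t * m / (b * n) + 4 * r / (c * |(n:ℝ)|)⌋

lemma card_Epairs (b bj c r : ℝ) (t n : ℤ) (hc : 0 < c) (hn : n ≠ 0) (hnr : |(n:ℝ)| ≤ r) :
    ((Epairs b bj c r t n).card : ℝ) ≤ 11 * (8 / c + 1) * r := by
  have hn1 : (1:ℝ) ≤ |(n:ℝ)| := by
    have : 1 ≤ |n| := Int.one_le_abs hn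
    exact_mod_cast this
  have hr0 : 0 < r := by linarith
  have hp : 0 < |(n:ℝ)| := by linarith
  rw [Epairs, Finset.card_sigma]
  push_cast
  have h1 : ∀ m ∈ Finset.Icc (-(|n| + 4)) (|n| + 4),
      ((Finset.Icc ⌈bj * t * m / (b * n) - 4 * r / (c * |(n:ℝ)|)⌉
      ⌊bj * t * m / (b * n) + 4 * r / (c * |(n:ℝ)|)⌋).card : ℝ) ≤ (8 / c + 1) * (r / |(n:ℝ)|) := by
    intro m _
    have h0 : 0 ≤ 4 * r / (c * |(n:ℝ)|) := by positivity
    refine (card_Icc_le _ _ (by linarith)).trans ?_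
    have h2 : 1 ≤ r / |(n:ℝ)| := by rwa [le_div_iff₀ hp, one_mul]
    have h3 : (8 / c + 1) * (r / |(n:ℝ)|) = 2 * (4 * r / (c * |(n:ℝ)|)) + r / |(n:ℝ)| := by
      field_simp; ring
    rw [h3]; linarith
  refine (Finset.sum_le_card_nsmul _ _ _ h1).trans ?_
  rw [nsmul_eq_mul]
  have h4 : ((Finset.Icc (-(|n| + 4)) (|n| + 4)).card : ℝ) ≤ 11 * |(n:ℝ)| := by
    rw [Int.card_Icc]
    have a := abs_nonneg n
    have h6 : (((|n| + 4 + 1 - -(|n| + 4)).toNat : ℤ) : ℝ) =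
        ((|n| + 4 + 1 - -(|n| + 4) : ℤ) : ℝ) := by
      rw [Int.toNat_of_nonneg (by omega)]
    rw [Int.cast_natCast] at h6
    rw [h6]; push_cast; linarith
  calc _ ≤ 11 * |(n:ℝ)| * ((8 / c + 1) * (r / |(n:ℝ)|)) := by gcongr
    _ = _ := by field_simp

lemma mem_Epairs {b bj c r : ℝ} {t n m x : ℤ} (hc : 0 < c) (hcb : c ≤ b) (hn : n ≠ 0)
    (hr : 0 ≤ r) (hm : |m| ≤ |n| + 4) (h : |b * x * n - bj * t * m| ≤ 4 * r) :
    (⟨m, x⟩ : Σ _ : ℤ, ℤ) ∈ Epairs b bj c r t n := by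
  have hb : 0 < b := by linarith
  have hn' : (n:ℝ) ≠ 0 := by exact_mod_cast hn
  have hp : 0 < |(n:ℝ)| := abs_pos.2 hn'
  have key : |(x:ℝ) - bj * t * m / (b * n)| ≤ 4 * r / (c * |(n:ℝ)|) := by
    have e : (x:ℝ) - bj * t * m / (b * n) = (b * x * n - bj * t * m) / (b * n) := by
      field_simp
    rw [e, abs_div, abs_mul, abs_of_pos hb]
    gcongr
  simp only [Epairs, Finset.mem_sigma, Finset.mem_Icc, Int.ceil_le, Int.le_floor]
  have k := abs_le.1 key
  have k2 := abs_le.1 hm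
  exact ⟨k2, by linarith, by linarith⟩

lemma count_class {β : Fin 3 → ℝ} {L u c : ℝ} {r : ℕ} (hu : 1 ≤ u) (hLu : L = u ^ 4)
    (hr1 : 64 * u ≤ r) (hrL : (r : ℝ) ≤ L) (hc : 0 < c) (hcβ : ∀ l, c ≤ β l)
    (A : Fin 3 → ℤ) (M : Finset (Fin 3 → ℤ)) 
    (i k j : Fin 3) (hsum : ∀ f : Fin 3 → ℝ, ∑ l, f l = f i + f k + f j)
    (hall : ∀ l, l = i ∨ l = k ∨ l = j)
    (hM : ∀ X ∈ M, (IBad 3 β L X ∧ euclNorm (fun j => (X j : ℝ) - A j) ≤ L) ∧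
      (r : ℝ) ≤ |β j * X j| ∧ ∀ l, |β l * X l| ≤ |β j * X j|) :
    (M.card : ℝ) ≤ (2 * L + 1) * (2 * r) * (11 * (8 / c + 1) * r) ^ 2 := by
  classical
  have hn : ∀ X ∈ M, ∃ ni nk nj : ℤ, nj ≠ 0 ∧ |nj| ≤ r ∧ |ni| ≤ |nj| + 4 ∧ |nk| ≤ |nj| + 4 ∧
      |β i * X i * nj - β j * X j * ni| ≤ 4 * r ∧ |β k * X k * nj - β j * X j * nk| ≤ 4 * r :=
    fun X hX => normal_of_bad hu hLu hr1 hrL (hM X hX).1.1 i k j hsum hall (hM X hX).2.1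
      ((hM X hX).2.2 i) ((hM X hX).2.2 k)
  choose! ni nk nj h0 h1 h2 h3 h4 h5 using hn
  have hr0 : (0:ℝ) < r := by linarith
  have hL0 : 0 < L := by linarith
  let T : Finset ℤ := Finset.Icc ⌈(A j : ℝ) - L⌉ ⌊(A j : ℝ) + L⌋
  let N : Finset ℤ := (Finset.Icc (-(r:ℤ)) r).erase 0
  let V := (T ×ˢ N).sigma fun p => Epairs (β i) (β j) c r p.1 p.2 ×ˢ Epairs (β k) (β j) c r p.1 p.2
  have hMV : M.card ≤ V.card := by
    apply Finset.card_le_card_of_injOn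
      (fun X => (⟨(X j, nj X), (⟨ni X, X i⟩, ⟨nk X, X k⟩)⟩ :
        Σ _ : ℤ × ℤ, (Σ _ : ℤ, ℤ) × (Σ _ : ℤ, ℤ)))
    · intro X hX
      have hX := Finset.mem_coe.1 hX
      rw [Finset.mem_coe]
      simp only [V, Finset.mem_sigma, Finset.mem_product]
      refine ⟨⟨?_, ?_⟩, ?_, ?_⟩
      · have := (abs_le_euclNorm (fun j => (X j : ℝ) - A j) j).trans (hM X hX).1.2
        have := abs_le.1 this
        simp only [T, Finset.mem_Icc, Int.ceil_le, Int.le_floor]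
        constructor <;> linarith
      · simp only [N, Finset.mem_erase, Finset.mem_Icc]
        exact ⟨h0 X hX, abs_le.1 (h1 X hX)⟩
      · exact mem_Epairs hc (hcβ i) (h0 X hX) hr0.le (h2 X hX) (h4 X hX)
      · exact mem_Epairs hc (hcβ k) (h0 X hX) hr0.le (h3 X hX) (h5 X hX)
    · intro X _ X' _ e
      simp only [Sigma.mk.injEq, heq_eq_eq, Prod.mk.injEq] at e
      obtain ⟨⟨e1, -⟩, ⟨-, e2⟩, ⟨-, e3⟩⟩ := e
      ext l
      rcases hall l with rfl | rfl | rfl <;> assumption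
  have hV : (V.card : ℝ) ≤ ((T ×ˢ N).card : ℝ) * (11 * (8 / c + 1) * r) ^ 2 := by
    rw [Finset.card_sigma]; push_cast
    rw [← nsmul_eq_mul]
    apply Finset.sum_le_card_nsmul
    rintro ⟨t, n⟩ hp
    simp only [N, Finset.mem_product, Finset.mem_erase, Finset.mem_Icc] at hp
    have hnr : |(n:ℝ)| ≤ r := by
      have : |n| ≤ r := abs_le.2 hp.2.2
      exact_mod_cast this
    rw [Finset.card_product]; push_cast
    have a1 := card_Epairs (β i) (β j) c r t n hc hp.2.1 hnr
    have a2 := card_Epairs (β k) (β j) c r t n hc hp.2.1 hnr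
    rw [sq]
    gcongr
  have hT : (T.card : ℝ) ≤ 2 * L + 1 :=
    (card_Icc_le _ _ (by linarith)).trans (by linarith)
  have hN : (N.card : ℝ) ≤ 2 * r := by
    have : N.card = 2 * r := by
      rw [Finset.card_erase_of_mem (by simp), Int.card_Icc]; omega
    rw [this]; push_cast; exact le_rfl
  have hTN : ((T ×ˢ N).card : ℝ) ≤ (2 * L + 1) * (2 * r) := by
    rw [Finset.card_product]; push_cast; gcongr
  calc (M.card : ℝ) ≤ V.card := by exact_mod_cast hMV
    _ ≤ _ := hV
    _ ≤ _ := by gcongr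

/-- lower bound for the coefficients -/
lemma lower_beta (C₀ : ℝ) : ∃ c : ℝ, 0 < c ∧ ∀ β : Fin 3 → ℝ, (∀ j, 0 < β j) →
      (∀ R : ℝ, 1 ≤ R →
        ((latticeTriples 3 β R).ncard : ℝ) ≤ C₀ * R ^ (3 * ((3:ℕ) : ℝ) - 4 + 1 / 6)) →
      ∀ j, c ≤ β j := by
  classical
  obtain ⟨m, hm⟩ := exists_nat_gt (max C₀ 1)
  have hmC : C₀ < m := lt_of_le_of_lt (le_max_left _ _) hm
  have hm1 : (1:ℝ) < m := lt_of_le_of_lt (le_max_right _ _) hm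
  refine ⟨1 / (2 * m) ^ 2, by positivity, ?_⟩
  intro β hβ hyp j
  by_contra! hlt
  set R : ℝ := 2 * m with hR
  have hR0 : 0 < R := by positivity
  have h1 := hyp R (by linarith)
  let bx := Fintype.piFinset (fun _ : Fin 3 => Finset.Icc (-(m:ℤ)) m)
  let V := (Finset.Icc (1:ℤ) (2 * m)) ×ˢ (bx ×ˢ bx)
  have hbx : ∀ Y ∈ bx, ∀ l, |(Y l : ℝ)| ≤ m := by
    intro Y hY l
    have := Fintype.mem_piFinset.1 hY l
    rw [Finset.mem_Icc] at this
    have : |Y l| ≤ m := abs_le.2 this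
    exact_mod_cast this
  have hbn : ∀ Y ∈ bx, euclNorm (fun l => (Y l : ℝ)) ≤ R := by
    intro Y hY
    unfold euclNorm
    apply Real.sqrt_le_iff.2 ⟨hR0.le, ?_⟩
    have : ∀ l, (Y l : ℝ) ^ 2 ≤ m ^ 2 := fun l => sq_le_sq' (abs_le.1 (hbx Y hY l)).1 (abs_le.1 (hbx Y hY l)).2
    rw [Fin.sum_univ_three, hR]
    nlinarith [this 0, this 1, this 2]
  let φ : ℤ × ((Fin 3 → ℤ) × (Fin 3 → ℤ)) → (Fin 3 → ℤ) × (Fin 3 → ℤ) × (Fin 3 → ℤ) :=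
    fun p => (Pi.single j p.1, p.2)
  have hcast : ∀ z : ℤ, (fun l => (((Pi.single j z : Fin 3 → ℤ) l : ℤ) : ℝ)) =
      (Pi.single j (z : ℝ) : Fin 3 → ℝ) := by
    intro z; ext l
    by_cases h : l = j
    · subst h; simp
    · simp [h]
  have hwin : ∀ (z : ℤ), 1 ≤ z → z ≤ 2 * m → ∀ Y ∈ bx,
      |winner β (Pi.single j (z : ℝ) : Fin 3 → ℝ) (fun l => (Y l : ℝ))| ≤ 1 := by
    intro z hz1 hz2 Y hY
    have : winner β (Pi.single j (z : ℝ) : Fin 3 → ℝ) (fun l => (Y l : ℝ)) = β j * z * Y j := by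
      unfold winner
      rw [Finset.sum_eq_single j]
      · simp
      · intro l _ hl; simp [hl]
      · simp
    rw [this, abs_mul, abs_mul, abs_of_pos (hβ j)]
    have hz1' : (1:ℝ) ≤ z := by exact_mod_cast hz1
    have hz2' : (z:ℝ) ≤ R := by rw [hR]; exact_mod_cast hz2
    rw [abs_of_pos (by linarith : (0:ℝ) < z)]
    have hy : |(Y j : ℝ)| ≤ R := (hbx Y hY j).trans (by rw [hR]; linarith)
    calc β j * z * |(Y j : ℝ)| ≤ (1 / R ^ 2) * R * R := by
          gcongr
      _ = 1 := by field_simp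
  have hsub : ((V.image φ : Finset _) : Set ((Fin 3 → ℤ) × (Fin 3 → ℤ) × (Fin 3 → ℤ))) ⊆
      latticeTriples 3 β R := by
    intro T hT
    obtain ⟨⟨z, Y, Z⟩, hp, rfl⟩ := Finset.mem_image.1 (Finset.mem_coe.1 hT)
    simp only [V, Finset.mem_product, Finset.mem_Icc] at hp
    obtain ⟨⟨hz1, hz2⟩, hY, hZ⟩ := hp
    refine ⟨?_, hbn Y hY, hbn Z hZ, ?_, ?_⟩
    · show euclNorm (fun l => (((Pi.single j z : Fin 3 → ℤ) l : ℤ) : ℝ)) ≤ R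
      rw [hcast]
      unfold euclNorm
      have : ∑ l, ((Pi.single j (z:ℝ) : Fin 3 → ℝ) l) ^ 2 = (z:ℝ) ^ 2 := by
        rw [Finset.sum_eq_single j]
        · simp
        · intro l _ hl; simp [hl]
        · simp
      have hz1' : (1:ℝ) ≤ z := by exact_mod_cast hz1
      rw [this, Real.sqrt_sq (by linarith), hR]
      exact_mod_cast hz2
    · show (Pi.single j z : Fin 3 → ℤ) ≠ 0
      intro h
      have := congrFun h j
      simp at this
      omega
    · show max |winner β (fun l => (((Pi.single j z : Fin 3 → ℤ) l : ℤ) : ℝ)) _|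
        |winner β (fun l => (((Pi.single j z : Fin 3 → ℤ) l : ℤ) : ℝ)) _| ≤ 1
      rw [hcast]
      exact max_le (hwin z hz1 hz2 Y hY) (hwin z hz1 hz2 Z hZ)
  have hφ : Function.Injective φ := by
    rintro ⟨z, p⟩ ⟨z', p'⟩ h
    simp only [φ, Prod.mk.injEq] at h
    obtain ⟨h1, rfl⟩ := h
    have := congrFun h1 j
    simp at this
    rw [this]
  have hVc : V.card = (2 * m) * ((2 * m + 1) ^ 3 * (2 * m + 1) ^ 3) := by
    have hb : bx.card = (2 * m + 1) ^ 3 := by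
      have h1 : ((m:ℤ) + 1 - -(m:ℤ)).toNat = 2 * m + 1 := by omega
      simp only [bx, Fintype.card_piFinset, Int.card_Icc, h1]
      simp
    simp only [V, Finset.card_product, hb, Int.card_Icc]
    congr 1
    omega
  have h2 : V.card ≤ (latticeTriples 3 β R).ncard := by
    rw [← Finset.card_image_of_injective V hφ, ← Set.ncard_coe_finset]
    exact Set.ncard_le_ncard hsub (finite_latticeTriples 3 β R)
  have h3 : (V.card : ℝ) ≤ (latticeTriples 3 β R).ncard := by exact_mod_cast h2
  have h4 : R ^ 7 ≤ (V.card : ℝ) := by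
    rw [hVc]; push_cast; rw [← hR]
    have : R ^ 7 = R * (R ^ 3 * R ^ 3) := by ring
    rw [this]
    gcongr <;> linarith
  have h5 : C₀ * R ^ (3 * ((3:ℕ) : ℝ) - 4 + 1 / 6) < R ^ 7 := by
    have a1 : R ^ (3 * ((3:ℕ) : ℝ) - 4 + 1 / 6) ≤ R ^ (6:ℝ) := by
      apply Real.rpow_le_rpow_of_exponent_le (by linarith)
      push_cast; norm_num
    have a2 : R ^ (6:ℝ) = R ^ 6 := by exact_mod_cast Real.rpow_natCast R 6
    rw [a2] at a1
    have a3 : 0 ≤ R ^ (3 * ((3:ℕ) : ℝ) - 4 + 1 / 6) := by positivity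
    have a4 : C₀ < R := by rw [hR]; linarith
    calc C₀ * R ^ (3 * ((3:ℕ) : ℝ) - 4 + 1 / 6) ≤ m * R ^ (3 * ((3:ℕ) : ℝ) - 4 + 1 / 6) := by gcongr
      _ ≤ m * R ^ 6 := by gcongr
      _ < R * R ^ 6 := by gcongr; linarith
      _ = R ^ 7 := by ring
  linarith

/-- the case `d = 3` -/
lemma case_three (C₀ : ℝ) :
    ∃ C : ℝ, ∀ β : Fin 3 → ℝ, (∀ j, 0 < β j) →
      (∀ R : ℝ, 1 ≤ R →
        ((latticeTriples 3 β R).ncard : ℝ) ≤ C₀ * R ^ (3 * ((3:ℕ) : ℝ) - 4 + 1 / 6)) →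
      ∀ L : ℝ, 2 ≤ L → ∀ (A : Fin 3 → ℤ) (M : Finset (Fin 3 → ℤ)),
      (∀ X ∈ M, IBad 3 β L X ∧ euclNorm (fun j => (X j : ℝ) - A j) ≤ L) →
        (M.card : ℝ) ≤ C * L ^ (((3:ℕ) : ℝ) - 1 - 1 / 4) := by
  classical
  obtain ⟨c, hc, hcβ⟩ := lower_beta C₀
  set K₁ : ℝ := (2 / c + 1) ^ 3 * 65 ^ 3 with hK1
  set K₂ : ℝ := 6 * (11 * (8 / c + 1)) ^ 2 * 65 ^ 3 with hK2
  have hK1p : 0 < K₁ := by positivity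
  have hK2p : 0 < K₂ := by positivity
  refine ⟨(2 * 625 + 1) ^ 3 + K₁ + 3 * K₂, ?_⟩
  intro β hβ hyp L hL A M hM
  have hcβ := hcβ β hβ hyp
  have hL0 : 0 < L := by linarith
  obtain ⟨u, hu⟩ : ∃ u : ℝ, u = L ^ (1 / 4 : ℝ) := ⟨_, rfl⟩
  have hu0 : 0 < u := by rw [hu]; positivity
  have hu1 : 1 ≤ u := by rw [hu]; exact Real.one_le_rpow (by linarith) (by norm_num)
  have hLu : L = u ^ 4 := by
    rw [hu, ← Real.rpow_natCast, ← Real.rpow_mul hL0.le]; norm_num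
  have hP : L ^ (((3:ℕ) : ℝ) - 1 - 1 / 4) = u ^ 7 := by
    rw [hLu, ← Real.rpow_natCast, ← Real.rpow_natCast, ← Real.rpow_mul hu0.le]
    congr 1; push_cast; norm_num
  rw [hP]
  have hu7 : 1 ≤ u ^ 7 := one_le_pow₀ hu1
  rcases lt_or_ge L 625 with hsmall | hbig
  · have h1 : M ⊆ ibox A L := fun X hX => mem_ibox.2 fun l =>
      (abs_le_euclNorm (fun j => (X j : ℝ) - A j) l).trans (hM X hX).2
    have h2 : (M.card : ℝ) ≤ (ibox A L).card := by exact_mod_cast Finset.card_le_card h1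
    have h3 := card_ibox_le A L hL0.le
    have h4 : (2 * L + 1) ^ 3 ≤ (2 * 625 + 1) ^ 3 := by gcongr
    have h5 : (2 * 625 + 1 : ℝ) ^ 3 ≤ (2 * 625 + 1) ^ 3 * u ^ 7 :=
      le_mul_of_one_le_right (by positivity) hu7
    have h6 : 0 ≤ (K₁ + 3 * K₂) * u ^ 7 := by positivity
    have h7 : ((2 * 625 + 1) ^ 3 + K₁ + 3 * K₂) * u ^ 7 =
      (2 * 625 + 1) ^ 3 * u ^ 7 + (K₁ + 3 * K₂) * u ^ 7 := by ring
    rw [h7]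
    linarith
  · have hu5 : 5 ≤ u := by
      by_contra! h
      have : u ^ 4 < 5 ^ 4 := by gcongr
      rw [← hLu] at this; linarith
    set r : ℕ := ⌈64 * u⌉₊ with hr
    have hr1 : 64 * u ≤ r := Nat.le_ceil _
    have hr2 : (r:ℝ) ≤ 65 * u := by
      have := Nat.ceil_lt_add_one (by positivity : 0 ≤ 64 * u)
      linarith
    have hrL : (r:ℝ) ≤ L := by
      have : (5:ℝ) ^ 3 ≤ u ^ 3 := by gcongr
      rw [hLu]
      nlinarith
    have hr0 : (0:ℝ) < r := by linarith
    let M0 := M.filter fun X => ∀ l, |β l * X l| < r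
    let Mc : Fin 3 → Finset (Fin 3 → ℤ) := fun j => M.filter fun X =>
      (r : ℝ) ≤ |β j * X j| ∧ ∀ l, |β l * X l| ≤ |β j * X j|
    have hcover : M ⊆ M0 ∪ (Mc 0 ∪ (Mc 1 ∪ Mc 2)) := by
      intro X hX
      obtain ⟨j, -, hj⟩ := Finset.exists_max_image (Finset.univ : Finset (Fin 3))
        (fun l => |β l * X l|) ⟨0, Finset.mem_univ _⟩
      have hj : ∀ l, |β l * X l| ≤ |β j * X j| := fun l => hj l (Finset.mem_univ _)
      by_cases h : |β j * X j| < r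
      · apply Finset.mem_union_left
        exact Finset.mem_filter.2 ⟨hX, fun l => (hj l).trans_lt h⟩
      · have hm : X ∈ Mc j := Finset.mem_filter.2 ⟨hX, not_lt.1 h, hj⟩
        simp only [Finset.mem_union]
        fin_cases j
        · exact Or.inr (Or.inl hm)
        · exact Or.inr (Or.inr (Or.inl hm))
        · exact Or.inr (Or.inr (Or.inr hm))
    have hcard : (M.card : ℝ) ≤ M0.card + ((Mc 0).card + ((Mc 1).card + (Mc 2).card)) := by
      have h1 := Finset.card_le_card hcover
      have h2 := Finset.card_union_le M0 (Mc 0 ∪ (Mc 1 ∪ Mc 2))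
      have h3 := Finset.card_union_le (Mc 0) (Mc 1 ∪ Mc 2)
      have h4 := Finset.card_union_le (Mc 1) (Mc 2)
      have : M.card ≤ M0.card + ((Mc 0).card + ((Mc 1).card + (Mc 2).card)) := by omega
      exact_mod_cast this
    have hM0 : (M0.card : ℝ) ≤ K₁ * u ^ 7 := by
      have h1 : M0 ⊆ ibox 0 (r / c) := by
        intro X hX
        have hX := (Finset.mem_filter.1 hX).2
        rw [mem_ibox]; intro l
        have := hX l
        rw [abs_mul, abs_of_pos (hβ l)] at this
        have h2 : c * |(X l : ℝ)| ≤ β l * |(X l : ℝ)| := by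
          have := hcβ l
          gcongr
        rw [le_div_iff₀ hc]
        simp only [Pi.zero_apply, Int.cast_zero, sub_zero]
        linarith
      have h2 : (M0.card : ℝ) ≤ (ibox (0 : Fin 3 → ℤ) (r / c)).card := by
        exact_mod_cast Finset.card_le_card h1
      have h3 := card_ibox_le (0 : Fin 3 → ℤ) (r / c) (by positivity)
      have h4 : 2 * (r / c) + 1 ≤ (2 / c + 1) * (65 * u) := by
        have : 2 * (r / c) + 1 ≤ (2 / c + 1) * r := by
          have : (1:ℝ) ≤ r := by linarith
          have e : (2 / c + 1) * (r:ℝ) = 2 * (r / c) + r := by ring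
          linarith
        refine this.trans ?_
        gcongr
      have h5 : (2 * (r / c) + 1) ^ 3 ≤ ((2 / c + 1) * (65 * u)) ^ 3 := by gcongr
      have h6 : ((2 / c + 1) * (65 * u)) ^ 3 = K₁ * u ^ 3 := by rw [hK1]; ring
      have h7 : K₁ * u ^ 3 ≤ K₁ * u ^ 7 := by
        exact mul_le_mul_of_nonneg_left (pow_le_pow_right₀ hu1 (by norm_num)) hK1p.le
      linarith
    have hfin : (2 * L + 1) * (2 * r) * (11 * (8 / c + 1) * r) ^ 2 ≤ K₂ * u ^ 7 := by
      calc (2 * L + 1) * (2 * r) * (11 * (8 / c + 1) * r) ^ 2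
          ≤ (3 * L) * (2 * (65 * u)) * (11 * (8 / c + 1) * (65 * u)) ^ 2 := by
            gcongr; linarith
        _ = K₂ * u ^ 7 := by rw [hK2, hLu]; ring
    have hMc : ∀ i k j : Fin 3, (∀ f : Fin 3 → ℝ, ∑ l, f l = f i + f k + f j) →
        (∀ l, l = i ∨ l = k ∨ l = j) → ((Mc j).card : ℝ) ≤ K₂ * u ^ 7 := by
      intro i k j hs ha
      refine (count_class hu1 hLu hr1 hrL hc hcβ A (Mc j) i k j hs ha ?_).trans hfin
      intro X hX
      have hX := Finset.mem_filter.1 hX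
      exact ⟨hM X hX.1, hX.2⟩
    have m0 := hMc 1 2 0 (fun f => by rw [Fin.sum_univ_three]; ring) (by decide)
    have m1 := hMc 0 2 1 (fun f => by rw [Fin.sum_univ_three]; ring) (by decide)
    have m2 := hMc 0 1 2 (fun f => by rw [Fin.sum_univ_three]) (by decide)
    have h7 : ((2 * 625 + 1) ^ 3 + K₁ + 3 * K₂) * u ^ 7 =
      (2 * 625 + 1) ^ 3 * u ^ 7 + K₁ * u ^ 7 + 3 * (K₂ * u ^ 7) := by ring
    rw [h7]
    have h8 : 0 ≤ (2 * 625 + 1 : ℝ) ^ 3 * u ^ 7 := by positivity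
    linarith

/-- Lemma A.6 of Deng–Hani (counting bad vectors): for `d ≥ 3` and any `C₀` there is a
constant `C = C(d, C₀)` such that whenever `β ∈ (ℝ⁺)^d` satisfies the triple-counting bound
with constant `C₀`, for every `L ≥ 2` and every `a ∈ Z_L^d` the number of `L`-bad vectors
`x` with `|x - a| ≤ 1` is at most `C L^{d - 1 - 1/4}`. -/
theorem count_bad_vectors (d : ℕ) (hd : 3 ≤ d) (C₀ : ℝ) :
    ∃ C : ℝ, ∀ β : Fin d → ℝ, (∀ j, 0 < β j) →
      (∀ R : ℝ, 1 ≤ R →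
        ((latticeTriples d β R).ncard : ℝ) ≤ C₀ * R ^ (3 * (d : ℝ) - 4 + 1 / 6)) →
      ∀ L : ℝ, 2 ≤ L → ∀ a : Fin d → ℝ, isLatticeVec d L a →
        {x : Fin d → ℝ | IsBadVec d β L x ∧ euclNorm (x - a) ≤ 1}.Finite ∧
        ({x : Fin d → ℝ | IsBadVec d β L x ∧ euclNorm (x - a) ≤ 1}.ncard : ℝ) ≤
          C * L ^ ((d : ℝ) - 1 - 1 / 4) := by
  rcases Nat.lt_or_ge d 4 with h | h
  · obtain rfl : d = 3 := by omega
    obtain ⟨C, hC⟩ := case_three C₀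
    exact ⟨C, fun β hβ hyp L hL a ha => reduce hL ha _ (hC β hβ hyp L hL)⟩
  · obtain ⟨C, hC⟩ := case_ge_four d h C₀
    exact ⟨C, fun β hβ hyp L hL a ha => reduce hL ha _ (hC β hyp L hL)⟩

end WKE
end
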